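/- arXiv:2512.03325 — 2 statements merged into one kernel-verified Lean document; each statement's English description precedes it below -/
import Mathlib

section
/- Partial Gaussian Equivalence Theorem (abstract interpolation bound). Fix integers K ≥ 1, K' ∈ {0,…,K}, and k_l ≥ 1 for l = 1,…,K, and set I := {(l,j) : 1 ≤ l ≤ K, 1 ≤ j ≤ k_l} and I_high := {(l,j) ∈ I : l > K'}. Let d ≥ 1, choose arbitrary coefficient vectors a_{lj} ∈ ℝ^{B_{d,l}} for (l,j) ∈ I, let x ~ N(0,I_d), and for each l > K' let g_l ~ N(0, I_{B_{d,l}}) be independent of each other and of x. For t ∈ [0,1] define s_{l,j}(t) := a_{lj}ᵀh_l(x) if l ≤ K', and s_{l,j}(t) := a_{lj}ᵀ(√(1−t)·h_l(x) + √t·g_l) if l > K'; set s(t) := (s_{l,j}(t))_{(l,j)∈I} ∈ ℝ^{k₁+⋯+k_K}. Then there exists a constant C > 0 depending only on K, K' and (k_l)_{l≤K} (in particular not on d or on the a_{lj}) such that for every twice continuously differentiable φ : ℝ^{k₁+⋯+k_K} → ℝ with sup_u ‖∇²φ(u)‖_op < ∞: |E[φ(s(0)) − φ(s(1))]| ≤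 C · sup_u‖∇²φ(u)‖_op · Σ_{α∈I_high} Σ_{β∈I} √(Var(⟨∇_x s_α(0), ∇_x s_β(0)⟩)), where ∇_x denotes the gradient with respect to x and Var is the variance over x ~ N(0,I_d). -/
/-!
Partial Gaussian Equivalence Theorem (abstract interpolation bound).
-/

noncomputable section

open MeasureTheory ProbabilityTheory

/-- The degree-`k` orthonormal probabilist's Hermite polynomial. -/
def He (k : ℕ) (x : ℝ) : ℝ :=
  (Polynomial.aeval x (Polynomial.hermite k)) / Real.sqrt (Nat.factorial k)

/-- Multi-indices on `Fin d` of total degree `k`. -/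
abbrev MIdx (d k : ℕ) : Type :=
  {κ : Fin d → ℕ // κ ∈ Finset.Nat.antidiagonalTuple d k}

/-- Euclidean dot product on `ι → ℝ`. -/
def dotp {ι : Type*} [Fintype ι] (u v : ι → ℝ) : ℝ := ∑ i, u i * v i

/-- The vector `h_k(x)` of all degree-`k` multivariate Hermite polynomials. -/
def hvec (d k : ℕ) (x : Fin d → ℝ) : MIdx d k → ℝ :=
  fun κ => ∏ i, He (κ.1 i) (x i)

/-- The standard Gaussian measure on `ι → ℝ`. -/
def stdG (ι : Type*) [Fintype ι] : Measure (ι → ℝ) :=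
  Measure.pi fun _ => gaussianReal 0 1

/-- Index set `I = {(l,j) : 1 ≤ l ≤ K, 1 ≤ j ≤ k_l}`. -/
abbrev PIdx (K : ℕ) (kl : ℕ → ℕ) : Type :=
  (l : {l : ℕ // l ∈ Finset.Icc 1 K}) × Fin (kl l.1)

/-- Sample space for the interpolation: `x ~ N(0,I_d)` together with independent
standard Gaussian families `g_l`, `l = 0,…,K`. -/
abbrev PΩ (d K : ℕ) : Type :=
  (Fin d → ℝ) × ((l : Fin (K + 1)) → MIdx d l.1 → ℝ)

/-- The law of the interpolation sample `(x, (g_l)_l)`. -/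
def PΩmeas (d K : ℕ) : Measure (PΩ d K) :=
  (stdG (Fin d)).prod (Measure.pi fun l : Fin (K + 1) => stdG (MIdx d l.1))

/-- The tuple-indexed interpolated chaos vector `s(t)`: coordinates of order `l ≤ K'`
stay `a_{lj}ᵀ h_l(x)`, coordinates of order `l > K'` become
`a_{lj}ᵀ(√(1−t)·h_l(x) + √t·g_l)`. -/
def sInterp (d K K' : ℕ) (kl : ℕ → ℕ)
    (a : (l : ℕ) → Fin (kl l) → MIdx d l → ℝ)
    (x : Fin d → ℝ) (g : (l : Fin (K + 1)) → MIdx d l.1 → ℝ) (t : ℝ) :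
    PIdx K kl → ℝ :=
  fun lj =>
    if lj.1.1 ≤ K' then dotp (a lj.1.1 lj.2) (hvec d lj.1.1 x)
    else
      Real.sqrt (1 - t) * dotp (a lj.1.1 lj.2) (hvec d lj.1.1 x) +
        Real.sqrt t *
          dotp (a lj.1.1 lj.2)
            (g ⟨lj.1.1, by have h := (Finset.mem_Icc.mp lj.1.2).2; omega⟩)

/-- The scalar chaos `x ↦ aᵀ h_l(x)`. -/
def chaosFn (d l : ℕ) (a : MIdx d l → ℝ) : (Fin d → ℝ) → ℝ :=
  fun x => dotp a (hvec d l x)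

/-- The inner product `⟨∇_x F(x), ∇_x G(x)⟩` of gradients. -/
def gradInner (d : ℕ) (F G : (Fin d → ℝ) → ℝ) (x : Fin d → ℝ) : ℝ :=
  ∑ i, fderiv ℝ F x (Pi.single i 1) * fderiv ℝ G x (Pi.single i 1)

set_option linter.unusedSectionVars false

/-! ### Functions of polynomial growth -/

section Growth

variable {E F G : Type*} [NormedAddCommGroup E] [NormedSpace ℝ E]
  [NormedAddCommGroup F] [NormedSpace ℝ F] [NormedAddCommGroup G] [NormedSpace ℝ G]

/-- Polynomial growth. -/
def PG (f : E → F) : Prop := ∃ C : ℝ, 0 ≤ C ∧ ∃ n : ℕ, ∀ x, ‖f x‖ ≤ C * (1 + ‖x‖) ^ n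

theorem PG.add {f g : E → F} (hf : PG f) (hg : PG g) : PG (fun x => f x + g x) := by
  obtain ⟨C, hC, n, h⟩ := hf
  obtain ⟨D, hD, m, k⟩ := hg
  refine ⟨C + D, by positivity, n + m, fun x => ?_⟩
  have h1 : (1:ℝ) ≤ 1 + ‖x‖ := by linarith [norm_nonneg x]
  have h2 : (1 + ‖x‖) ^ n ≤ (1 + ‖x‖) ^ (n + m) := pow_le_pow_right₀ h1 (by omega)
  have h3 : (1 + ‖x‖) ^ m ≤ (1 + ‖x‖) ^ (n + m) := pow_le_pow_right₀ h1 (by omega)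
  calc ‖f x + g x‖ ≤ ‖f x‖ + ‖g x‖ := norm_add_le _ _
    _ ≤ C * (1 + ‖x‖) ^ n + D * (1 + ‖x‖) ^ m := add_le_add (h x) (k x)
    _ ≤ C * (1 + ‖x‖) ^ (n + m) + D * (1 + ‖x‖) ^ (n + m) := by gcongr
    _ = _ := by ring

theorem PG.mul_bound {f : E → F} {g : E → G} {H : Type*} [NormedAddCommGroup H]
    [NormedSpace ℝ H] {k : E → H} (hf : PG f) (hg : PG g)
    (hk : ∀ x, ‖k x‖ ≤ ‖f x‖ * ‖g x‖) : PG k := by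
  obtain ⟨C, hC, n, h⟩ := hf
  obtain ⟨D, hD, m, h'⟩ := hg
  refine ⟨C * D, by positivity, n + m, fun x => (hk x).trans ?_⟩
  calc ‖f x‖ * ‖g x‖ ≤ (C * (1 + ‖x‖) ^ n) * (D * (1 + ‖x‖) ^ m) :=
        mul_le_mul (h x) (h' x) (norm_nonneg _) (by positivity)
    _ = _ := by ring

theorem PG.mono {f : E → F} {g : E → G} (hf : PG f) (h : ∀ x, ‖g x‖ ≤ ‖f x‖) : PG g := by
  obtain ⟨C, hC, n, h'⟩ := hf
  exact ⟨C, hC, n, fun x => (h x).trans (h' x)⟩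

theorem PG.const (c : F) : PG (fun _ : E => c) :=
  ⟨‖c‖, norm_nonneg _, 0, fun x => by simp⟩

theorem PG.mul {f g : E → ℝ} (hf : PG f) (hg : PG g) : PG (fun x => f x * g x) :=
  hf.mul_bound hg (fun x => by simp)

theorem PG.sum {ι : Type*} (s : Finset ι) {f : ι → E → F} (h : ∀ i ∈ s, PG (f i)) :
    PG (fun x => ∑ i ∈ s, f i x) := by
  classical
  induction s using Finset.induction_on with
  | empty => simpa using PG.const (0 : F)
  | insert a s ha ih =>
    simp only [Finset.sum_insert ha]
    exact (h a (by simp)).add (ih fun i hi => h i (by simp [hi]))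

theorem PG.comp {g : F → G} {f : E → F} (hg : PG g) (hf : PG f) : PG (fun x => g (f x)) := by
  obtain ⟨C, hC, n, h⟩ := hg
  obtain ⟨D, hD, m, h'⟩ := hf
  refine ⟨C * (1 + D) ^ n, by positivity, m * n, fun x => ?_⟩
  have h1 : (1:ℝ) ≤ (1 + ‖x‖) ^ m := one_le_pow₀ (by linarith [norm_nonneg x])
  calc ‖g (f x)‖ ≤ C * (1 + ‖f x‖) ^ n := h _
    _ ≤ C * ((1 + D) * (1 + ‖x‖) ^ m) ^ n := by
        gcongr
        nlinarith [h' x]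
    _ = _ := by rw [mul_pow, ← pow_mul]; ring

/-- `C¹` functions which together with their derivative have polynomial growth. -/
structure Nice (f : E → F) : Prop where
  cd : ContDiff ℝ 1 f
  pg : PG f
  pg' : PG (fderiv ℝ f)

theorem Nice.diff {f : E → F} (hf : Nice f) (x : E) : DifferentiableAt ℝ f x :=
  hf.cd.differentiable (by norm_num) x

theorem Nice.cont {f : E → F} (hf : Nice f) : Continuous f := hf.cd.continuous

theorem Nice.cont' {f : E → F} (hf : Nice f) : Continuous (fderiv ℝ f) :=
  hf.cd.continuous_fderiv (by norm_num)

theorem Nice.cont'_apply {f : E → F} (hf : Nice f) (e : E) :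
    Continuous (fun x => fderiv ℝ f x e) := hf.cont'.clm_apply continuous_const

theorem Nice.pg'_apply {f : E → F} (hf : Nice f) (e : E) : PG (fun x => fderiv ℝ f x e) :=
  hf.pg'.mul_bound (PG.const e) (fun x => (fderiv ℝ f x).le_opNorm e)

theorem Nice.const (c : F) : Nice (fun _ : E => c) :=
  ⟨contDiff_const, PG.const c, by
    have : fderiv ℝ (fun _ : E => c) = fun _ => 0 := by ext x; simp
    rw [this]; exact PG.const _⟩

theorem Nice.clm (L : E →L[ℝ] F) : Nice (fun x => L x) :=
  ⟨L.contDiff, ⟨‖L‖, norm_nonneg _, 1, fun x => (L.le_opNorm x).trans (by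
      have := norm_nonneg L; rw [pow_one]; nlinarith)⟩, by
    have : fderiv ℝ (fun x => L x) = fun _ => L := by ext x; simp
    rw [this]; exact PG.const _⟩

theorem Nice.add {f g : E → F} (hf : Nice f) (hg : Nice g) : Nice (fun x => f x + g x) :=
  ⟨hf.cd.add hg.cd, hf.pg.add hg.pg, by
    have : fderiv ℝ (fun x => f x + g x) = fun x => fderiv ℝ f x + fderiv ℝ g x := by
      funext x; exact fderiv_fun_add (hf.diff x) (hg.diff x)
    rw [this]; exact hf.pg'.add hg.pg'⟩

theorem Nice.mul {f g : E → ℝ} (hf : Nice f) (hg : Nice g) : Nice (fun x => f x * g x) :=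
  ⟨hf.cd.mul hg.cd, hf.pg.mul hg.pg, by
    have : fderiv ℝ (fun x => f x * g x) =
        fun x => f x • fderiv ℝ g x + g x • fderiv ℝ f x := by
      funext x; exact fderiv_fun_mul (hf.diff x) (hg.diff x)
    rw [this]
    exact (hf.pg.mul_bound hg.pg' fun x => (norm_smul _ _).le).add
      (hg.pg.mul_bound hf.pg' fun x => (norm_smul _ _).le)⟩

theorem Nice.sum {ι : Type*} (s : Finset ι) {f : ι → E → F} (h : ∀ i ∈ s, Nice (f i)) :
    Nice (fun x => ∑ i ∈ s, f i x) := by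
  classical
  induction s using Finset.induction_on with
  | empty => simpa using Nice.const (0 : F)
  | insert a s ha ih =>
    simp only [Finset.sum_insert ha]
    exact (h a (by simp)).add (ih fun i hi => h i (by simp [hi]))

theorem Nice.comp {g : F → G} {f : E → F} (hg : Nice g) (hf : Nice f) :
    Nice (fun x => g (f x)) :=
  ⟨hg.cd.comp hf.cd, hg.pg.comp hf.pg, by
    have : fderiv ℝ (fun x => g (f x)) = fun x => (fderiv ℝ g (f x)).comp (fderiv ℝ f x) := by
      funext x; exact fderiv_fun_comp x (hg.diff _) (hf.diff x)
    rw [this]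
    exact (hg.pg'.comp hf.pg).mul_bound hf.pg' fun x => ContinuousLinearMap.opNorm_comp_le _ _⟩

theorem Nice.pi {ι : Type*} [Fintype ι] {f : E → ι → ℝ} (h : ∀ i, Nice (fun x => f x i)) :
    Nice f := by
  classical
  have : f = fun x => ∑ i, ContinuousLinearMap.toSpanSingleton ℝ (Pi.single i (1:ℝ) : ι → ℝ)
      (f x i) := by
    funext x j
    simp [Finset.sum_apply, Pi.single_apply]
  rw [this]
  exact Nice.sum _ fun i _ => (Nice.clm _).comp (h i)

end Growth

/-! ### Moments and Gaussian integration by parts -/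

section Stein

variable {E F : Type*} [NormedAddCommGroup E] [NormedSpace ℝ E] [MeasurableSpace E]
  [BorelSpace E] [SecondCountableTopology E]
  [NormedAddCommGroup F] [NormedSpace ℝ F] [MeasurableSpace F]
  [BorelSpace F] [SecondCountableTopology F]

/-- All moments of the norm are finite. -/
def Mom (μ : Measure E) : Prop := ∀ n : ℕ, Integrable (fun x => (1 + ‖x‖) ^ n) μ

theorem Mom.integrable {μ : Measure E} (hμ : Mom μ) {f : E → ℝ} (hc : Continuous f)
    (hf : PG f) : Integrable f μ := by
  obtain ⟨C, hC, n, h⟩ := hf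
  exact ((hμ n).const_mul C).mono' hc.aestronglyMeasurable (Filter.Eventually.of_forall h)

theorem Mom.prod {μ : Measure E} {ν : Measure F} [SFinite μ] [SFinite ν]
    (hμ : Mom μ) (hν : Mom ν) : Mom (μ.prod ν) := by
  intro n
  refine ((hμ n).mul_prod (hν n)).mono' (by fun_prop) (Filter.Eventually.of_forall fun z => ?_)
  have h1 := norm_nonneg z.1
  have h2 := norm_nonneg z.2
  rw [Real.norm_of_nonneg (by positivity), ← mul_pow]
  gcongr
  rcases max_cases ‖z.1‖ ‖z.2‖ with h | h <;> rw [Prod.norm_def, h.1] <;> nlinarith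

theorem Mom.pi {ι : Type*} [Fintype ι] {E : ι → Type*} [∀ i, NormedAddCommGroup (E i)]
    [∀ i, NormedSpace ℝ (E i)] [∀ i, MeasurableSpace (E i)] [∀ i, BorelSpace (E i)]
    [∀ i, SecondCountableTopology (E i)] {μ : ∀ i, Measure (E i)} [∀ i, SigmaFinite (μ i)]
    (h : ∀ i, Mom (μ i)) : Mom (Measure.pi μ) := by
  intro n
  refine (Integrable.fintype_prod_dep (f := fun i (y : E i) => (1 + ‖y‖) ^ n)
    (fun i => h i n)).mono' (by fun_prop) (Filter.Eventually.of_forall fun z => ?_)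
  rw [Real.norm_of_nonneg (by positivity), Finset.prod_pow]
  gcongr
  have h1 : ∀ i, (1:ℝ) ≤ 1 + ‖z i‖ := fun i => by linarith [norm_nonneg (z i)]
  have h2 : (1:ℝ) ≤ ∏ i, (1 + ‖z i‖) := by
    calc (1:ℝ) = ∏ i : ι, (1:ℝ) := by simp
      _ ≤ _ := Finset.prod_le_prod (fun _ _ => zero_le_one) (fun i _ => h1 i)
  have h3 : ‖z‖ ≤ ∏ i, (1 + ‖z i‖) - 1 := by
    refine (pi_norm_le_iff_of_nonneg (by linarith)).2 fun i => ?_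
    classical
    rw [← Finset.mul_prod_erase _ _ (Finset.mem_univ i)]
    have h4 : (1:ℝ) ≤ ∏ j ∈ Finset.univ.erase i, (1 + ‖z j‖) := by
      calc (1:ℝ) = ∏ j ∈ Finset.univ.erase i, (1:ℝ) := by simp
        _ ≤ _ := Finset.prod_le_prod (fun _ _ => zero_le_one) (fun i _ => h1 i)
    nlinarith [norm_nonneg (z i)]
  linarith

theorem Mom.gauss : Mom (gaussianReal 0 1) := by
  intro n
  have h1 : MemLp (fun x : ℝ => 1 + ‖x‖) (n : ENNReal) (gaussianReal 0 1) :=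
    (memLp_const (1 : ℝ)).add
      (MemLp.norm (memLp_id_gaussianReal' (μ := 0) (v := 1) (n : ENNReal) (by simp)))
  have := h1.integrable_norm_pow'
  refine this.congr (Filter.Eventually.of_forall fun x => ?_)
  have := norm_nonneg x
  simp only
  rw [Real.norm_of_nonneg (by positivity)]

/-- Gaussian integration by parts for the linear functional `c` in direction `e`. -/
def SteinP (μ : Measure E) (c : E →L[ℝ] ℝ) (e : E) : Prop :=
  ∀ f : E → ℝ, Nice f → ∫ x, c x * f x ∂μ = ∫ x, fderiv ℝ f x e ∂μ

theorem SteinP.prod_left {μ : Measure E} {ν : Measure F} [SFinite μ] [SFinite ν]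
    (hμ : Mom μ) (hν : Mom ν) {c : E →L[ℝ] ℝ} {e : E} (h : SteinP μ c e) :
    SteinP (μ.prod ν) (c.comp (ContinuousLinearMap.fst ℝ E F)) (e, 0) := by
  intro f hf
  have hm := hμ.prod hν
  have hcf := (Nice.clm (c.comp (ContinuousLinearMap.fst ℝ E F))).mul hf
  rw [integral_prod_symm _ (hm.integrable hcf.cont hcf.pg),
    integral_prod_symm _ (hm.integrable (hf.cont'_apply _) (hf.pg'_apply _))]
  refine integral_congr_ae (Filter.Eventually.of_forall fun y => ?_)
  have hA : Nice (fun x : E => ContinuousLinearMap.inl ℝ E F x + ((0 : E), y)) :=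
    (Nice.clm _).add (Nice.const _)
  have := h _ (hf.comp hA)
  have h2 : ∀ x, fderiv ℝ (fun x => f (ContinuousLinearMap.inl ℝ E F x + ((0 : E), y))) x e =
      fderiv ℝ f (x, y) (e, 0) := by
    intro x
    rw [fderiv_fun_comp x (hf.diff _) (hA.diff x), fderiv_add_const, ContinuousLinearMap.fderiv]
    simp
  simp only [h2] at this
  simpa using this

theorem SteinP.prod_right {μ : Measure E} {ν : Measure F} [SFinite μ] [SFinite ν]
    (hμ : Mom μ) (hν : Mom ν) {c : F →L[ℝ] ℝ} {e : F} (h : SteinP ν c e) :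
    SteinP (μ.prod ν) (c.comp (ContinuousLinearMap.snd ℝ E F)) (0, e) := by
  intro f hf
  have hm := hμ.prod hν
  have hcf := (Nice.clm (c.comp (ContinuousLinearMap.snd ℝ E F))).mul hf
  rw [integral_prod _ (hm.integrable hcf.cont hcf.pg),
    integral_prod _ (hm.integrable (hf.cont'_apply _) (hf.pg'_apply _))]
  refine integral_congr_ae (Filter.Eventually.of_forall fun y => ?_)
  have hA : Nice (fun x : F => ContinuousLinearMap.inr ℝ E F x + (y, (0 : F))) :=
    (Nice.clm _).add (Nice.const _)
  have := h _ (hf.comp hA)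
  have h2 : ∀ x, fderiv ℝ (fun x => f (ContinuousLinearMap.inr ℝ E F x + (y, (0 : F)))) x e =
      fderiv ℝ f (y, x) (0, e) := by
    intro x
    rw [fderiv_fun_comp x (hf.diff _) (hA.diff x), fderiv_add_const, ContinuousLinearMap.fderiv]
    simp
  simp only [h2] at this
  simpa using this

theorem map_update_pi {ι : Type*} [Fintype ι] [DecidableEq ι] {E : ι → Type*}
    [∀ i, MeasurableSpace (E i)] (μ : ∀ i, Measure (E i)) [∀ i, IsProbabilityMeasure (μ i)]
    (i : ι) :
    MeasurePreserving (fun z : (∀ j, E j) × E i => Function.update z.1 i z.2)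
      ((Measure.pi μ).prod (μ i)) (Measure.pi μ) := by
  have hmeas : Measurable (fun z : (∀ j, E j) × E i => Function.update z.1 i z.2) := by
    refine measurable_pi_lambda _ fun j => ?_
    by_cases hj : j = i
    · subst hj; simpa using measurable_snd
    · simp only [Function.update_of_ne hj]; fun_prop
  refine ⟨hmeas, (Measure.pi_eq fun s hs => ?_).symm⟩
  rw [Measure.map_apply hmeas (MeasurableSet.univ_pi hs)]
  have : (fun z : (∀ j, E j) × E i => Function.update z.1 i z.2) ⁻¹' Set.univ.pi s =
      (Set.univ.pi (Function.update s i Set.univ)) ×ˢ s i := by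
    ext ⟨x, y⟩
    simp only [Set.mem_preimage, Set.mem_pi, Set.mem_univ, true_imp_iff, Set.mem_prod]
    constructor
    · intro h
      refine ⟨fun j => ?_, by simpa using h i⟩
      by_cases hj : j = i
      · subst hj; simp
      · simpa [Function.update_of_ne hj] using h j
    · rintro ⟨h1, h2⟩ j
      by_cases hj : j = i
      · subst hj; simpa using h2
      · simpa [Function.update_of_ne hj] using h1 j
  rw [this, Measure.prod_prod, Measure.pi_pi, ← Finset.prod_erase_mul _ _ (Finset.mem_univ i),
    ← Finset.prod_erase_mul _ (fun j => μ j (s j)) (Finset.mem_univ i)]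
  simp only [Function.update_self, measure_univ, mul_one]
  congr 1
  refine Finset.prod_congr rfl fun j hj => ?_
  rw [Function.update_of_ne (Finset.ne_of_mem_erase hj)]

theorem SteinP.pi {ι : Type*} [Fintype ι] [DecidableEq ι] {E : ι → Type*}
    [∀ i, NormedAddCommGroup (E i)]
    [∀ i, NormedSpace ℝ (E i)] [∀ i, MeasurableSpace (E i)] [∀ i, BorelSpace (E i)]
    [∀ i, SecondCountableTopology (E i)] {μ : ∀ i, Measure (E i)}
    [∀ i, IsProbabilityMeasure (μ i)]
    (hm : ∀ i, Mom (μ i)) (i : ι) {c : E i →L[ℝ] ℝ} {e : E i} (h : SteinP (μ i) c e) :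
    SteinP (Measure.pi μ) (c.comp (ContinuousLinearMap.proj i)) (Pi.single i e) := by
  intro f hf
  have hp := map_update_pi μ i
  have hM := Mom.pi hm
  have key : ∀ g : (∀ j, E j) → ℝ, Continuous g → PG g →
      ∫ x, g x ∂(Measure.pi μ) = ∫ x, ∫ y, g (Function.update x i y) ∂(μ i) ∂(Measure.pi μ) := by
    intro g hg hg'
    have hi := hM.integrable hg hg'
    have h1 : ∫ x, g x ∂(Measure.pi μ) = ∫ z, g (Function.update z.1 i z.2)
        ∂((Measure.pi μ).prod (μ i)) := by
      conv_lhs => rw [← hp.map_eq]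
      exact integral_map hp.measurable.aemeasurable (by rw [hp.map_eq]; exact hi.1)
    rw [h1, integral_prod]
    exact hp.integrable_comp_of_integrable hi
  have hcf := (Nice.clm (c.comp (ContinuousLinearMap.proj (φ := E) i))).mul hf
  rw [key _ hcf.cont hcf.pg, key _ (hf.cont'_apply _) (hf.pg'_apply _)]
  refine integral_congr_ae (Filter.Eventually.of_forall fun x => ?_)
  have hA : Nice (fun y : E i => ContinuousLinearMap.single ℝ E i y + Function.update x i 0) :=
    (Nice.clm _).add (Nice.const _)
  have hA' : ∀ y, ContinuousLinearMap.single ℝ E i y + Function.update x i 0 =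
      Function.update x i y := by
    intro y
    ext j
    by_cases hj : j = i
    · subst hj; simp
    · simp [hj]
  have := h _ (hf.comp hA)
  have h2 : ∀ y, fderiv ℝ (fun y => f (ContinuousLinearMap.single ℝ E i y +
      Function.update x i 0)) y e = fderiv ℝ f (Function.update x i y) (Pi.single i e) := by
    intro y
    rw [fderiv_fun_comp y (hf.diff _) (hA.diff y), hA', fderiv_add_const]
    rw [ContinuousLinearMap.fderiv]
    rfl
  simp only [h2] at this
  simp only [hA'] at this
  simpa using this

theorem SteinP.add {μ : Measure E} (hμ : Mom μ) {c c' : E →L[ℝ] ℝ} {e e' : E}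
    (h : SteinP μ c e) (h' : SteinP μ c' e') : SteinP μ (c + c') (e + e') := by
  intro f hf
  have i1 := (Nice.clm c).mul hf
  have i2 := (Nice.clm c').mul hf
  simp only [add_apply, add_mul, map_add]
  rw [integral_add (hμ.integrable i1.cont i1.pg) (hμ.integrable i2.cont i2.pg),
    integral_add (hμ.integrable (hf.cont'_apply _) (hf.pg'_apply _))
      (hμ.integrable (hf.cont'_apply _) (hf.pg'_apply _)), h f hf, h' f hf]

theorem SteinP.smul {μ : Measure E} {c : E →L[ℝ] ℝ} {e : E}
    (h : SteinP μ c e) (r : ℝ) : SteinP μ (r • c) (r • e) := by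
  intro f hf
  simp only [smul_apply, smul_eq_mul, map_smul, mul_assoc]
  rw [integral_const_mul, integral_const_mul, h f hf]

theorem SteinP.sum {μ : Measure E} (hμ : Mom μ) {ι : Type*} (s : Finset ι)
    {c : ι → E →L[ℝ] ℝ} {e : ι → E} (h : ∀ i, SteinP μ (c i) (e i)) :
    SteinP μ (∑ i ∈ s, c i) (∑ i ∈ s, e i) := by
  classical
  induction s using Finset.induction_on with
  | empty => intro f hf; simp
  | insert a s ha ih => rw [Finset.sum_insert ha, Finset.sum_insert ha]; exact (h a).add hμ ih

theorem SteinP.gauss : SteinP (gaussianReal 0 1) (ContinuousLinearMap.id ℝ ℝ) 1 := by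
  intro f hf
  have hder : ∀ x, HasDerivAt (gaussianPDFReal 0 1) (-x * gaussianPDFReal 0 1 x) x := by
    intro x
    have h1 : HasDerivAt (fun x : ℝ => -(x - 0) ^ 2 / (2 * ((1 : NNReal) : ℝ))) (-x) x := by
      have := ((((hasDerivAt_id x).sub_const 0).pow 2).neg).div_const (2 * ((1 : NNReal) : ℝ))
      convert! this using 1
      simp
      ring
    have h2 := (h1.exp).const_mul ((Real.sqrt (2 * Real.pi * ((1 : NNReal) : ℝ)))⁻¹)
    rw [gaussianPDFReal_def]
    convert! h2 using 1
    ring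
  have hI : ∀ g : ℝ → ℝ, Integrable g (gaussianReal 0 1) →
      Integrable (fun x => gaussianPDFReal 0 1 x * g x) := by
    intro g hg
    rw [gaussianReal_of_var_ne_zero _ one_ne_zero] at hg
    rw [integrable_withDensity_iff_integrable_smul' (measurable_gaussianPDF 0 1)
      (Filter.Eventually.of_forall fun x => by simp [gaussianPDF])] at hg
    simpa [gaussianPDF, ENNReal.toReal_ofReal, gaussianPDFReal_nonneg] using hg
  have hxf := (Nice.clm (ContinuousLinearMap.id ℝ ℝ)).mul hf
  have i1 := hI _ (Mom.gauss.integrable hxf.cont hxf.pg)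
  have i2 := hI _ (Mom.gauss.integrable (hf.cont'_apply 1) (hf.pg'_apply 1))
  have i3 := hI _ (Mom.gauss.integrable hf.cont hf.pg)
  have := integral_mul_deriv_eq_deriv_mul_of_integrable (u := f) (v := gaussianPDFReal 0 1)
    (u' := fun x => fderiv ℝ f x 1) (v' := fun x => -x * gaussianPDFReal 0 1 x)
    (fun x _ => (hf.diff x).hasFDerivAt.hasDerivAt) (fun x _ => hder x)
    (by
      refine i1.neg.congr (Filter.Eventually.of_forall fun x => ?_)
      simp; ring)
    (by
      refine i2.congr (Filter.Eventually.of_forall fun x => ?_)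
      simp; ring)
    (by
      refine i3.congr (Filter.Eventually.of_forall fun x => ?_)
      simp; ring)
  rw [integral_gaussianReal_eq_integral_smul one_ne_zero,
    integral_gaussianReal_eq_integral_smul one_ne_zero]
  have h4 : ∫ x, gaussianPDFReal 0 1 x • (ContinuousLinearMap.id ℝ ℝ x * f x) =
      - ∫ x, f x * (-x * gaussianPDFReal 0 1 x) := by
    rw [← integral_neg]
    congr 1; funext x; simp; ring
  rw [h4, this, neg_neg]
  congr 1; funext x; simp; ring

end Stein

/-! ### Hermite polynomials -/

section Hermite

open Polynomial in
theorem hermite_derivative (n : ℕ) :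
    derivative (hermite (n + 1)) = ((n : ℤ[X]) + 1) * hermite n := by
  induction n with
  | zero => simp
  | succ n ih =>
    rw [hermite_succ (n + 1), derivative_sub, derivative_mul, ih, derivative_mul]
    rw [hermite_succ n]
    simp
    ring

/-- Hermite polynomials with real coefficients. -/
def hR (n : ℕ) : Polynomial ℝ := (Polynomial.hermite n).map (Int.castRingHom ℝ)

open Polynomial in
theorem hR_succ (n : ℕ) : hR (n + 1) = X * hR n - derivative (hR n) := by
  simp [hR, hermite_succ, derivative_map]

open Polynomial in
theorem hR_derivative (n : ℕ) : derivative (hR (n + 1)) = ((n : ℝ[X]) + 1) * hR n := by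
  rw [hR, derivative_map, hermite_derivative]
  simp [hR]

open Polynomial in
theorem hR_ode (n : ℕ) :
    X * derivative (hR n) - derivative (derivative (hR n)) = (n : ℝ[X]) * hR n := by
  cases n with
  | zero => simp [hR]
  | succ n =>
    rw [hR_derivative, derivative_mul, hR_succ]
    simp
    ring

theorem He_eq (k : ℕ) (x : ℝ) : He k x = (hR k).eval x / Real.sqrt (Nat.factorial k) := by
  rw [He, hR, Polynomial.eval_map, Polynomial.aeval_def]
  rfl

theorem Nice.poly (p : Polynomial ℝ) : Nice (fun x : ℝ => p.eval x) := by
  induction p using Polynomial.induction_on' with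
  | add p q hp hq => simpa using hp.add hq
  | monomial n a =>
    simp only [Polynomial.eval_monomial]
    refine (Nice.const a).mul ?_
    induction n with
    | zero => simpa using Nice.const (E := ℝ) (1 : ℝ)
    | succ n ih =>
      simp only [pow_succ]
      exact ih.mul (Nice.clm (ContinuousLinearMap.id ℝ ℝ))

theorem fderiv_poly (p : Polynomial ℝ) (x : ℝ) :
    fderiv ℝ (fun x : ℝ => p.eval x) x 1 = p.derivative.eval x := by
  rw [(p.hasDerivAt x).hasFDerivAt.fderiv]
  simp

theorem hR_integral_succ (n : ℕ) (p : Polynomial ℝ) :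
    ∫ x, (hR (n + 1)).eval x * p.eval x ∂(gaussianReal 0 1) =
      ∫ x, (hR n).eval x * p.derivative.eval x ∂(gaussianReal 0 1) := by
  have h := SteinP.gauss _ (Nice.poly (hR n * p))
  simp only [fderiv_poly] at h
  have I : ∀ q : Polynomial ℝ, Integrable (fun x => q.eval x) (gaussianReal 0 1) :=
    fun q => Mom.gauss.integrable (Nice.poly q).cont (Nice.poly q).pg
  have e1 : ∀ x, (hR (n + 1)).eval x * p.eval x =
      (Polynomial.X * (hR n * p)).eval x - (Polynomial.derivative (hR n) * p).eval x := by
    intro x; rw [hR_succ]; simp; ring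
  have e2 : ∀ x, (hR n).eval x * p.derivative.eval x =
      (Polynomial.derivative (hR n * p)).eval x - (Polynomial.derivative (hR n) * p).eval x := by
    intro x; simp [Polynomial.derivative_mul]
  simp only [e1, e2]
  rw [integral_sub (I _) (I _), integral_sub (I _) (I _), ← h]
  simp

theorem hR_orth (n m : ℕ) :
    ∫ x, (hR n).eval x * (hR m).eval x ∂(gaussianReal 0 1) =
      if n = m then (Nat.factorial n : ℝ) else 0 := by
  induction n generalizing m with
  | zero =>
    cases m with
    | zero => simp [hR]
    | succ m =>
      have := hR_integral_succ m (hR 0)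
      simp only [mul_comm ((hR 0).eval _)]
      rw [this]
      simp [hR]
  | succ n ih =>
    rw [hR_integral_succ]
    cases m with
    | zero => simp [hR]
    | succ m =>
      rw [hR_derivative]
      have : ∀ x, (hR n).eval x * (((m : Polynomial ℝ) + 1) * hR m).eval x =
          ((m : ℝ) + 1) * ((hR n).eval x * (hR m).eval x) := by
        intro x; simp; ring
      simp only [this]
      rw [integral_const_mul, ih]
      by_cases h : n = m
      · subst h; simp [Nat.factorial_succ]
      · simp [h]

theorem He_orth (n m : ℕ) :
    ∫ x, He n x * He m x ∂(gaussianReal 0 1) = if n = m then 1 else 0 := by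
  have : ∀ x, He n x * He m x = (Real.sqrt (Nat.factorial n) * Real.sqrt (Nat.factorial m))⁻¹ *
      ((hR n).eval x * (hR m).eval x) := by
    intro x; rw [He_eq, He_eq]; rw [mul_inv]; ring
  simp only [this]
  rw [integral_const_mul, hR_orth]
  by_cases h : n = m
  · subst h
    have : (Nat.factorial n : ℝ) ≠ 0 := by positivity
    simp [this]
  · simp [h]

theorem hvec_orth (d l : ℕ) (κ κ' : MIdx d l) :
    ∫ x, hvec d l x κ * hvec d l x κ' ∂(stdG (Fin d)) = if κ = κ' then 1 else 0 := by
  simp only [hvec, ← Finset.prod_mul_distrib]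
  rw [stdG, integral_fintype_prod_eq_prod (f := fun i y => He (κ.1 i) y * He (κ'.1 i) y)]
  simp only [He_orth]
  by_cases h : κ = κ'
  · subst h; simp
  · rw [if_neg h]
    have : ∃ i, κ.1 i ≠ κ'.1 i := by
      by_contra hc
      push Not at hc
      exact h (Subtype.ext (funext hc))
    obtain ⟨i, hi⟩ := this
    exact Finset.prod_eq_zero (Finset.mem_univ i) (if_neg hi)

end Hermite

section MvPoly

open MvPolynomial

variable {d : ℕ}

theorem Nice.mvpoly (P : MvPolynomial (Fin d) ℝ) :
    Nice (fun x : Fin d → ℝ => MvPolynomial.eval x P) := by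
  induction P using MvPolynomial.induction_on with
  | C a => simpa using Nice.const a
  | add p q hp hq => simpa using hp.add hq
  | mul_X p i hp =>
    simpa using hp.mul (Nice.clm (ContinuousLinearMap.proj (R := ℝ) (φ := fun _ : Fin d => ℝ) i))

theorem fderiv_mvpoly (P : MvPolynomial (Fin d) ℝ) (x : Fin d → ℝ) (i : Fin d) :
    fderiv ℝ (fun x : Fin d → ℝ => MvPolynomial.eval x P) x (Pi.single i 1) =
      MvPolynomial.eval x (pderiv i P) := by
  induction P using MvPolynomial.induction_on with
  | C a => simp
  | add p q hp hq =>
    simp only [map_add]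
    rw [fderiv_fun_add ((Nice.mvpoly p).diff x) ((Nice.mvpoly q).diff x)]
    simp [hp, hq]
  | mul_X p j hp =>
    simp only [map_mul, eval_X]
    have h2 : HasFDerivAt (fun x : Fin d → ℝ => x j)
        (ContinuousLinearMap.proj (R := ℝ) (φ := fun _ : Fin d => ℝ) j) x :=
      (ContinuousLinearMap.proj (R := ℝ) (φ := fun _ : Fin d => ℝ) j).hasFDerivAt
    rw [fderiv_fun_mul ((Nice.mvpoly p).diff x) h2.differentiableAt, h2.fderiv]
    simp [hp, pderiv_X, Pi.single_apply]
    by_cases h : i = j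
    · subst h; simp
    · simp [Ne.symm h]

/-- The eigenvalue equation of the Ornstein-Uhlenbeck generator. -/
def Eig (l : ℕ) (P : MvPolynomial (Fin d) ℝ) : Prop :=
  ∑ i, (X i * pderiv i P - pderiv i (pderiv i P)) = (l : MvPolynomial (Fin d) ℝ) * P

theorem Eig.sum {l : ℕ} {ι : Type*} (s : Finset ι) (c : ι → ℝ)
    {P : ι → MvPolynomial (Fin d) ℝ} (h : ∀ k, Eig l (P k)) : Eig l (∑ k ∈ s, C (c k) * P k) := by
  unfold Eig at *
  simp only [map_sum, pderiv_C_mul, Finset.mul_sum]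
  simp only [← Finset.sum_sub_distrib]
  rw [Finset.sum_comm]
  refine Finset.sum_congr rfl fun k _ => ?_
  have := congrArg (fun z => C (c k) * z) (h k)
  simp only [Finset.mul_sum] at this
  rw [mul_left_comm, ← this]
  refine Finset.sum_congr rfl fun i _ => ?_
  ring

theorem pderiv_aeval_ne {i j : Fin d} (h : j ≠ i) (q : Polynomial ℝ) :
    pderiv i (Polynomial.aeval (X j : MvPolynomial (Fin d) ℝ) q) = 0 := by
  rw [Derivation.map_aeval, pderiv_X_of_ne h, smul_zero]

theorem pderiv_prod_zero {i : Fin d} (s : Finset (Fin d)) (hi : i ∉ s)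
    (q : Fin d → Polynomial ℝ) :
    pderiv i (∏ j ∈ s, Polynomial.aeval (X j : MvPolynomial (Fin d) ℝ) (q j)) = 0 := by
  induction s using Finset.induction_on with
  | empty => simp
  | insert a s ha ih =>
    simp only [Finset.mem_insert, not_or] at hi
    rw [Finset.prod_insert ha, pderiv_mul, ih hi.2, pderiv_aeval_ne (Ne.symm hi.1)]
    simp

theorem pderiv_aeval_mul {i : Fin d} (q : Polynomial ℝ) {R : MvPolynomial (Fin d) ℝ}
    (hR : pderiv i R = 0) :
    pderiv i (Polynomial.aeval (X i : MvPolynomial (Fin d) ℝ) q * R) =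
      Polynomial.aeval (X i : MvPolynomial (Fin d) ℝ) (Polynomial.derivative q) * R := by
  rw [pderiv_mul, hR, Derivation.map_aeval, pderiv_X_self]
  simp

theorem Eig.hermite (l : ℕ) (κ : Fin d → ℕ) (hκ : ∑ i, κ i = l) :
    Eig l (∏ j, Polynomial.aeval (X j : MvPolynomial (Fin d) ℝ) (hR (κ j))) := by
  unfold Eig
  rw [← hκ, Nat.cast_sum, Finset.sum_mul]
  refine Finset.sum_congr rfl fun i _ => ?_
  have h0 := pderiv_prod_zero (i := i) (Finset.univ.erase i) (by simp) (fun j => hR (κ j))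
  rw [← Finset.mul_prod_erase _ _ (Finset.mem_univ i), pderiv_aeval_mul _ h0,
    pderiv_aeval_mul _ h0]
  have := congrArg (Polynomial.aeval (X i : MvPolynomial (Fin d) ℝ)) (hR_ode (κ i))
  simp only [map_sub, map_mul, Polynomial.aeval_X, map_natCast] at this
  rw [← mul_assoc, ← mul_assoc, ← this]
  ring

/-- The polynomial of a chaos. -/
def chaosPoly (d l : ℕ) (a : MIdx d l → ℝ) : MvPolynomial (Fin d) ℝ :=
  ∑ κ : MIdx d l, C (a κ * ∏ i, (Real.sqrt (Nat.factorial (κ.1 i)))⁻¹) *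
    ∏ j, Polynomial.aeval (X j : MvPolynomial (Fin d) ℝ) (hR (κ.1 j))

theorem chaosPoly_eig (d l : ℕ) (a : MIdx d l → ℝ) : Eig l (chaosPoly d l a) :=
  Eig.sum _ _ fun κ => Eig.hermite l κ.1 (Finset.Nat.mem_antidiagonalTuple.1 κ.2)

theorem chaosFn_eq (d l : ℕ) (a : MIdx d l → ℝ) :
    chaosFn d l a = fun x => MvPolynomial.eval x (chaosPoly d l a) := by
  funext x
  simp only [chaosFn, dotp, chaosPoly, hvec, map_sum, map_mul, eval_C, map_prod]
  refine Finset.sum_congr rfl fun κ _ => ?_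
  rw [mul_assoc, ← Finset.prod_mul_distrib]
  congr 1
  refine Finset.prod_congr rfl fun i _ => ?_
  rw [He_eq, div_eq_inv_mul]
  congr 1
  rw [Polynomial.aeval_def, Polynomial.hom_eval₂]
  simp only [eval_X, Polynomial.eval]
  congr 1
  ext z
  simp

theorem gradInner_eq (l m : ℕ) (a : MIdx d l → ℝ) (b : MIdx d m → ℝ) (x : Fin d → ℝ) :
    gradInner d (chaosFn d l a) (chaosFn d m b) x =
      ∑ i, MvPolynomial.eval x (pderiv i (chaosPoly d l a)) *
        MvPolynomial.eval x (pderiv i (chaosPoly d m b)) := by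
  simp only [gradInner, chaosFn_eq, fderiv_mvpoly]

/-- Integration by parts against an eigenfunction. -/
theorem eig_ibp {E : Type*} [NormedAddCommGroup E] [NormedSpace ℝ E] [MeasurableSpace E]
    [BorelSpace E] [SecondCountableTopology E] {μ : Measure E} (hμ : Mom μ)
    (p : E →L[ℝ] (Fin d → ℝ)) (e : Fin d → E) (he : ∀ i, p (e i) = Pi.single i 1)
    (hs : ∀ i, SteinP μ ((ContinuousLinearMap.proj (R := ℝ) (φ := fun _ : Fin d => ℝ) i).comp p)
      (e i)) {l : ℕ} {P : MvPolynomial (Fin d) ℝ} (hP : Eig l P) {f : E → ℝ} (hf : Nice f) :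
    (l : ℝ) * ∫ z, MvPolynomial.eval (p z) P * f z ∂μ =
      ∫ z, ∑ i, MvPolynomial.eval (p z) (pderiv i P) * fderiv ℝ f z (e i) ∂μ := by
  have hN : ∀ Q : MvPolynomial (Fin d) ℝ, Nice (fun z => MvPolynomial.eval (p z) Q) :=
    fun Q => (Nice.mvpoly Q).comp (Nice.clm p)
  have hD : ∀ (Q : MvPolynomial (Fin d) ℝ) (z : E) (i : Fin d),
      fderiv ℝ (fun z => MvPolynomial.eval (p z) Q) z (e i) =
        MvPolynomial.eval (p z) (pderiv i Q) := by
    intro Q z i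
    rw [fderiv_fun_comp z ((Nice.mvpoly Q).diff _) p.differentiableAt, p.fderiv,
      ContinuousLinearMap.comp_apply, he, fderiv_mvpoly]
  rw [← integral_const_mul]
  have e1 : ∀ z, (l : ℝ) * (MvPolynomial.eval (p z) P * f z) =
      ∑ i, (p z i * (MvPolynomial.eval (p z) (pderiv i P) * f z) -
        MvPolynomial.eval (p z) (pderiv i (pderiv i P)) * f z) := by
    intro z
    have := congrArg (MvPolynomial.eval (p z)) hP
    simp only [map_sum, map_sub, map_mul, eval_X, map_natCast] at this
    rw [← mul_assoc, ← this, Finset.sum_mul]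
    refine Finset.sum_congr rfl fun i _ => ?_
    ring
  have hx : ∀ i, Nice (fun z => p z i) := fun i =>
    Nice.clm ((ContinuousLinearMap.proj (R := ℝ) (φ := fun _ : Fin d => ℝ) i).comp p)
  have n1 : ∀ i, Nice (fun z => p z i * (MvPolynomial.eval (p z) (pderiv i P) * f z)) :=
    fun i => (hx i).mul ((hN _).mul hf)
  have n2 : ∀ i, Nice (fun z => MvPolynomial.eval (p z) (pderiv i (pderiv i P)) * f z) :=
    fun i => (hN _).mul hf
  have i1 : ∀ i, Integrable (fun z => p z i * (MvPolynomial.eval (p z) (pderiv i P) * f z)) μ :=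
    fun i => hμ.integrable (n1 i).cont (n1 i).pg
  have i2 : ∀ i, Integrable
      (fun z => MvPolynomial.eval (p z) (pderiv i (pderiv i P)) * f z) μ :=
    fun i => hμ.integrable (n2 i).cont (n2 i).pg
  have i3 : ∀ i, Integrable
      (fun z => MvPolynomial.eval (p z) (pderiv i P) * fderiv ℝ f z (e i)) μ :=
    fun i => hμ.integrable ((hN _).cont.mul (hf.cont'_apply _)) ((hN _).pg.mul (hf.pg'_apply _))
  simp only [e1]
  have i12 : ∀ i, Integrable (fun z => p z i * (MvPolynomial.eval (p z) (pderiv i P) * f z) -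
      MvPolynomial.eval (p z) (pderiv i (pderiv i P)) * f z) μ := fun i => (i1 i).sub (i2 i)
  rw [integral_finsetSum _ (fun i _ => i12 i), integral_finsetSum _ (fun i _ => i3 i)]
  refine Finset.sum_congr rfl fun i _ => ?_
  rw [integral_sub (i1 i) (i2 i)]
  have := hs i _ ((hN (pderiv i P)).mul hf)
  have h3 : ∀ z, fderiv ℝ (fun z => MvPolynomial.eval (p z) (pderiv i P) * f z) z (e i) =
      MvPolynomial.eval (p z) (pderiv i P) * fderiv ℝ f z (e i) +
        MvPolynomial.eval (p z) (pderiv i (pderiv i P)) * f z := by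
    intro z
    rw [fderiv_fun_mul ((hN _).diff z) (hf.diff z)]
    simp only [add_apply, smul_apply, smul_eq_mul, hD]
    ring
  simp only [h3] at this
  rw [integral_add (i3 i) (i2 i)] at this
  simp only [ContinuousLinearMap.comp_apply, ContinuousLinearMap.proj_apply] at this
  rw [this]
  ring

theorem Mom.stdG (ι : Type*) [Fintype ι] : Mom (stdG ι) := Mom.pi fun _ => Mom.gauss

instance stdG_prob (ι : Type*) [Fintype ι] : IsProbabilityMeasure (stdG ι) := by
  unfold _root_.stdG; infer_instance

theorem SteinP.stdG {ι : Type*} [Fintype ι] [DecidableEq ι] (i : ι) :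
    SteinP (stdG ι) (ContinuousLinearMap.proj (R := ℝ) (φ := fun _ : ι => ℝ) i)
      (Pi.single i 1) := by
  have := SteinP.pi (μ := fun _ : ι => gaussianReal 0 1) (fun _ => Mom.gauss) i SteinP.gauss
  exact this

theorem chaos_inner (l : ℕ) (a b : MIdx d l → ℝ) :
    ∫ x, chaosFn d l a x * chaosFn d l b x ∂(stdG (Fin d)) = dotp a b := by
  have h : ∀ x, chaosFn d l a x * chaosFn d l b x =
      ∑ κ, ∑ κ', (a κ * b κ') * (hvec d l x κ * hvec d l x κ') := by
    intro x
    simp only [chaosFn, dotp, Finset.sum_mul_sum]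
    refine Finset.sum_congr rfl fun κ _ => Finset.sum_congr rfl fun κ' _ => ?_
    ring
  have hn : ∀ κ, Nice (fun x => hvec d l x κ) := by
    intro κ
    have h1 := Nice.mvpoly (chaosPoly d l (Pi.single κ 1))
    rw [← chaosFn_eq] at h1
    have : chaosFn d l (Pi.single κ 1) = fun x => hvec d l x κ := by
      funext x; simp [chaosFn, dotp, Pi.single_apply]
    rwa [this] at h1
  have hi : ∀ κ κ', Integrable (fun x => (a κ * b κ') * (hvec d l x κ * hvec d l x κ'))
      (stdG (Fin d)) := fun κ κ' => by
    have := (hn κ).mul (hn κ')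
    exact ((Mom.stdG _).integrable this.cont this.pg).const_mul _
  simp only [h]
  rw [integral_finsetSum _ fun κ _ => integrable_finsetSum _ fun κ' _ => hi κ κ']
  refine Finset.sum_congr rfl fun κ _ => ?_
  rw [integral_finsetSum _ fun κ' _ => hi κ κ']
  simp only [integral_const_mul, hvec_orth]
  simp

theorem grad_integral (l m : ℕ) (a : MIdx d l → ℝ) (b : MIdx d m → ℝ) :
    ∫ x, gradInner d (chaosFn d l a) (chaosFn d m b) x ∂(stdG (Fin d)) =
      l * ∫ x, chaosFn d l a x * chaosFn d m b x ∂(stdG (Fin d)) := by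
  have := eig_ibp (Mom.stdG (Fin d)) (ContinuousLinearMap.id ℝ (Fin d → ℝ))
    (fun i => Pi.single i 1) (fun i => rfl) (fun i => SteinP.stdG i) (chaosPoly_eig d l a)
    (Nice.mvpoly (chaosPoly d m b))
  simp only [gradInner_eq]
  simp only [chaosFn_eq]
  simp only [fderiv_mvpoly] at this
  exact this.symm

theorem chaos_inner_ne {l m : ℕ} (hlm : l ≠ m) (a : MIdx d l → ℝ) (b : MIdx d m → ℝ) :
    ∫ x, chaosFn d l a x * chaosFn d m b x ∂(stdG (Fin d)) = 0 := by
  have h1 := grad_integral l m a b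
  have h2 := grad_integral m l b a
  have h3 : ∀ x, gradInner d (chaosFn d m b) (chaosFn d l a) x =
      gradInner d (chaosFn d l a) (chaosFn d m b) x := by
    intro x; simp only [gradInner, mul_comm]
  simp only [h3, mul_comm (chaosFn d m b _)] at h2
  rw [h1] at h2
  have h4 : ((l : ℝ) - m) ≠ 0 := sub_ne_zero.2 (by exact_mod_cast hlm)
  have h5 : ((l : ℝ) - m) * ∫ x, chaosFn d l a x * chaosFn d m b x ∂(stdG (Fin d)) = 0 := by
    rw [sub_mul, h2, sub_self]
  exact (mul_eq_zero.1 h5).resolve_left h4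

end MvPoly

/-! ### The abstract interpolation bound -/

section Abstract

theorem PG.of_fderiv {E F : Type*} [NormedAddCommGroup E] [NormedSpace ℝ E]
    [NormedAddCommGroup F] [NormedSpace ℝ F] {f : E → F} (hd : Differentiable ℝ f)
    (h : PG (fderiv ℝ f)) : PG f := by
  obtain ⟨C, hC, n, h⟩ := h
  refine ⟨‖f 0‖ + C, by positivity, n + 1, fun x => ?_⟩
  have h0 := norm_nonneg x
  have h1 := (convex_closedBall (0 : E) ‖x‖).norm_image_sub_le_of_norm_fderiv_le (𝕜 := ℝ) (f := f)
    (C := C * (1 + ‖x‖) ^ n) (x := 0) (y := x) (fun y _ => hd y)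
    (fun y hy => (h y).trans (by
      have : ‖y‖ ≤ ‖x‖ := by simpa using hy
      gcongr)) (by simp) (by simp)
  have h2 : ‖f x‖ ≤ ‖f 0‖ + ‖f x - f 0‖ := by
    have := norm_add_le (f 0) (f x - f 0)
    simpa using this
  rw [sub_zero] at h1
  have h3 : (1:ℝ) ≤ (1 + ‖x‖) ^ (n + 1) := one_le_pow₀ (by linarith)
  have h4 : C * (1 + ‖x‖) ^ n * ‖x‖ ≤ C * (1 + ‖x‖) ^ (n + 1) := by
    rw [pow_succ, ← mul_assoc]
    gcongr
    linarith
  nlinarith [norm_nonneg (f 0)]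

variable {I : Type*} [Fintype I] [DecidableEq I]

theorem clm_pi_sum {F : Type*} [NormedAddCommGroup F] [NormedSpace ℝ F]
    (L : (I → ℝ) →L[ℝ] F) (v : I → ℝ) :
    L v = ∑ i, v i • L (Pi.single i 1) := by
  have : v = ∑ i, v i • (Pi.single i 1 : I → ℝ) := by
    funext j
    simp [Finset.sum_apply, Pi.single_apply]
  conv_lhs => rw [this]
  simp only [map_sum, map_smul]

theorem second_bound {φ : (I → ℝ) → ℝ} {M : ℝ}
    (hM : ∀ u, ‖iteratedFDeriv ℝ 2 φ u‖ ≤ M) (u : I → ℝ) :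
    ‖fderiv ℝ (fderiv ℝ φ) u‖ ≤ M := by
  have hM0 : 0 ≤ M := (norm_nonneg _).trans (hM u)
  refine ContinuousLinearMap.opNorm_le_bound _ hM0 fun v => ?_
  refine ContinuousLinearMap.opNorm_le_bound _ (by positivity) fun w => ?_
  have h1 := iteratedFDeriv_two_apply (𝕜 := ℝ) φ u ![v, w]
  simp only [Matrix.cons_val_zero, Matrix.cons_val_one] at h1
  rw [← h1]
  refine ((iteratedFDeriv ℝ 2 φ u).le_opNorm _).trans ?_
  simp only [Fin.prod_univ_two, Matrix.cons_val_zero, Matrix.cons_val_one]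
  rw [mul_assoc]
  exact mul_le_mul_of_nonneg_right (hM u) (by positivity)

theorem nice_fderiv {φ : (I → ℝ) → ℝ} (hφ : ContDiff ℝ 2 φ) {M : ℝ}
    (hM : ∀ u, ‖iteratedFDeriv ℝ 2 φ u‖ ≤ M) : Nice (fderiv ℝ φ) := by
  have hM0 : 0 ≤ M := (norm_nonneg _).trans (hM 0)
  have h1 : ContDiff ℝ 1 (fderiv ℝ φ) := hφ.fderiv_right (by norm_num)
  have h2 : PG (fderiv ℝ (fderiv ℝ φ)) := ⟨M, hM0, 0, fun u => by simpa using second_bound hM u⟩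
  exact ⟨h1, PG.of_fderiv (h1.differentiable (by norm_num)) h2, h2⟩

theorem nice_phi {φ : (I → ℝ) → ℝ} (hφ : ContDiff ℝ 2 φ) {M : ℝ}
    (hM : ∀ u, ‖iteratedFDeriv ℝ 2 φ u‖ ≤ M) : Nice φ :=
  ⟨hφ.of_le (by norm_num), PG.of_fderiv (hφ.differentiable (by norm_num)) (nice_fderiv hφ hM).pg,
    (nice_fderiv hφ hM).pg⟩

/-- Partial derivative. -/
def pd (α : I) (φ : (I → ℝ) → ℝ) (u : I → ℝ) : ℝ := fderiv ℝ φ u (Pi.single α 1)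

theorem nice_pd {φ : (I → ℝ) → ℝ} (hφ : ContDiff ℝ 2 φ) {M : ℝ}
    (hM : ∀ u, ‖iteratedFDeriv ℝ 2 φ u‖ ≤ M) (α : I) : Nice (pd α φ) :=
  (Nice.clm (ContinuousLinearMap.apply ℝ ℝ (Pi.single α 1 : I → ℝ))).comp (nice_fderiv hφ hM)

theorem pd_pd_bound {φ : (I → ℝ) → ℝ} (hφ : ContDiff ℝ 2 φ) {M : ℝ}
    (hM : ∀ u, ‖iteratedFDeriv ℝ 2 φ u‖ ≤ M) (α β : I) (u : I → ℝ) :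
    ‖pd β (pd α φ) u‖ ≤ M := by
  have h1 : pd β (pd α φ) u = fderiv ℝ (fderiv ℝ φ) u (Pi.single β 1) (Pi.single α 1) := by
    have := ((ContinuousLinearMap.apply ℝ ℝ (Pi.single α 1 : I → ℝ)).hasFDerivAt.comp u
      ((nice_fderiv hφ hM).diff u).hasFDerivAt).fderiv
    have h2 : (⇑(ContinuousLinearMap.apply ℝ ℝ (Pi.single α 1 : I → ℝ)) ∘ fderiv ℝ φ) = pd α φ :=
      rfl
    rw [h2] at this
    rw [pd, this]
    rfl
  rw [h1]
  have n1 : ∀ γ : I, ‖(Pi.single γ 1 : I → ℝ)‖ = 1 := fun γ => by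
    rw [Pi.norm_single]; simp
  calc _ ≤ ‖fderiv ℝ (fderiv ℝ φ) u (Pi.single β 1)‖ * ‖(Pi.single α 1 : I → ℝ)‖ :=
        ContinuousLinearMap.le_opNorm _ _
    _ ≤ (‖fderiv ℝ (fderiv ℝ φ) u‖ * ‖(Pi.single β 1 : I → ℝ)‖) * ‖(Pi.single α 1 : I → ℝ)‖ := by
        gcongr
        exact ContinuousLinearMap.le_opNorm _ _
    _ ≤ M := by
        rw [n1, n1, mul_one, mul_one]; exact second_bound hM u

variable {E : Type*} [NormedAddCommGroup E] [NormedSpace ℝ E] [MeasurableSpace E]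
    [BorelSpace E] [SecondCountableTopology E]

/-- The interpolation path. -/
def SS (hi : I → Prop) [DecidablePred hi] (Fa Za : I → E → ℝ) (θ : ℝ) (z : E) : I → ℝ :=
  fun α => if hi α then Real.cos θ * Fa α z + Real.sin θ * Za α z else Fa α z

/-- The velocity of the interpolation path. -/
def SS' (hi : I → Prop) [DecidablePred hi] (Fa Za : I → E → ℝ) (θ : ℝ) (z : E) : I → ℝ :=
  fun α => if hi α then -Real.sin θ * Fa α z + Real.cos θ * Za α z else 0

theorem nice_SS_apply (hi : I → Prop) [DecidablePred hi] {Fa Za : I → E → ℝ}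
    (nF : ∀ α, Nice (Fa α)) (nZ : ∀ α, Nice (Za α)) (θ : ℝ) (α : I) :
    Nice (fun z => SS hi Fa Za θ z α) := by
  by_cases h : hi α
  · simp only [SS, if_pos h]
    exact ((Nice.const _).mul (nF α)).add ((Nice.const _).mul (nZ α))
  · simp only [SS, if_neg h]
    exact nF α

theorem nice_SS (hi : I → Prop) [DecidablePred hi] {Fa Za : I → E → ℝ}
    (nF : ∀ α, Nice (Fa α)) (nZ : ∀ α, Nice (Za α)) (θ : ℝ) :
    Nice (SS hi Fa Za θ) := Nice.pi fun α => nice_SS_apply hi nF nZ θ α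

theorem nice_SS'_apply (hi : I → Prop) [DecidablePred hi] {Fa Za : I → E → ℝ}
    (nF : ∀ α, Nice (Fa α)) (nZ : ∀ α, Nice (Za α)) (θ : ℝ) (α : I) :
    Nice (fun z => SS' hi Fa Za θ z α) := by
  by_cases h : hi α
  · simp only [SS', if_pos h]
    exact ((Nice.const _).mul (nF α)).add ((Nice.const _).mul (nZ α))
  · simp only [SS', if_neg h]
    exact Nice.const _

theorem hasDerivAt_SS (hi : I → Prop) [DecidablePred hi] (Fa Za : I → E → ℝ) (θ : ℝ) (z : E) :
    HasDerivAt (fun θ => SS hi Fa Za θ z) (SS' hi Fa Za θ z) θ := by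
  refine hasDerivAt_pi.2 fun α => ?_
  by_cases h : hi α
  · simp only [SS, SS', if_pos h]
    exact ((Real.hasDerivAt_cos θ).mul_const _).add ((Real.hasDerivAt_sin θ).mul_const _)
  · simp only [SS, SS', if_neg h]
    exact hasDerivAt_const _ _

theorem abs_comb_le {c s x y : ℝ} (hc : |c| ≤ 1) (hs : |s| ≤ 1) : |c * x + s * y| ≤ |x| + |y| := by
  calc |c * x + s * y| ≤ |c * x| + |s * y| := abs_add_le _ _
    _ = |c| * |x| + |s| * |y| := by rw [abs_mul, abs_mul]
    _ ≤ 1 * |x| + 1 * |y| := by gcongr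
    _ = _ := by ring

theorem hasDerivAt_integral {μ : Measure E} (hμ : Mom μ) (hi : I → Prop)
    [DecidablePred hi] {Fa Za : I → E → ℝ}
    (nF : ∀ α, Nice (Fa α)) (nZ : ∀ α, Nice (Za α)) {φ : (I → ℝ) → ℝ} (hφ : ContDiff ℝ 2 φ) {M : ℝ}
    (hM : ∀ u, ‖iteratedFDeriv ℝ 2 φ u‖ ≤ M) (θ : ℝ) :
    HasDerivAt (fun θ => ∫ z, φ (SS hi Fa Za θ z) ∂μ)
      (∫ z, ∑ α, SS' hi Fa Za θ z α * pd α φ (SS hi Fa Za θ z) ∂μ) θ := by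
  have hN := nice_phi hφ hM
  set B : E → ℝ := fun z => ∑ α, (|Fa α z| + |Za α z|) with hB
  have hBc : Continuous B :=
    continuous_finsetSum _ fun α _ => (nF α).cont.abs.add (nZ α).cont.abs
  have hBp : PG B := PG.sum _ fun α _ =>
    PG.add ((nF α).pg.mono fun z => by simp) ((nZ α).pg.mono fun z => by simp)
  have hB0 : ∀ z, 0 ≤ B z := fun z => Finset.sum_nonneg fun α _ => by positivity
  have hle : ∀ z α, |Fa α z| + |Za α z| ≤ B z := fun z α =>
    Finset.single_le_sum (f := fun α => |Fa α z| + |Za α z|)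
      (fun α _ => by positivity) (Finset.mem_univ α)
  have hS : ∀ θ z, ‖SS hi Fa Za θ z‖ ≤ B z := by
    intro θ z
    refine (pi_norm_le_iff_of_nonneg (hB0 z)).2 fun α => (?_ : |_| ≤ _).trans (hle z α)
    unfold SS
    split_ifs
    · exact abs_comb_le (Real.abs_cos_le_one _) (Real.abs_sin_le_one _)
    · linarith [abs_nonneg (Za α z)]
  have hS' : ∀ θ z, ‖SS' hi Fa Za θ z‖ ≤ B z := by
    intro θ z
    refine (pi_norm_le_iff_of_nonneg (hB0 z)).2 fun α => (?_ : |_| ≤ _).trans (hle z α)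
    unfold SS'
    split_ifs
    · exact abs_comb_le (by rw [abs_neg]; exact Real.abs_sin_le_one _) (Real.abs_cos_le_one _)
    · rw [abs_zero]; positivity
  obtain ⟨C, hC, n, hCn⟩ := hN.pg'
  have hbn := (Nice.poly (Polynomial.C C * (1 + Polynomial.X) ^ n * Polynomial.X))
  have hbi := hμ.integrable (hbn.cont.comp hBc) (hbn.pg.comp hBp)
  have hsum : ∀ θ z, ∑ α, SS' hi Fa Za θ z α * pd α φ (SS hi Fa Za θ z) =
      fderiv ℝ φ (SS hi Fa Za θ z) (SS' hi Fa Za θ z) := by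
    intro θ z
    rw [clm_pi_sum]
    rfl
  have hFn : ∀ θ, Nice (fun z => φ (SS hi Fa Za θ z)) := fun θ => hN.comp (nice_SS hi nF nZ θ)
  have := hasDerivAt_integral_of_dominated_loc_of_deriv_le (μ := μ) (𝕜 := ℝ) (s := Set.univ)
    (x₀ := θ)
    (F := fun θ z => φ (SS hi Fa Za θ z))
    (F' := fun θ z => ∑ α, SS' hi Fa Za θ z α * pd α φ (SS hi Fa Za θ z))
    Filter.univ_mem
    (Filter.Eventually.of_forall fun θ => (hFn θ).cont.aestronglyMeasurable)
    (hμ.integrable (hFn θ).cont (hFn θ).pg)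
    (Continuous.aestronglyMeasurable (continuous_finsetSum _ fun α _ =>
      (nice_SS'_apply hi nF nZ θ α).cont.mul
        ((nice_pd hφ hM α).cont.comp (nice_SS hi nF nZ θ).cont)))
    (Filter.Eventually.of_forall fun z θ _ => ?_) hbi
    (Filter.Eventually.of_forall fun z θ _ => ?_)
  · exact this.2
  · rw [hsum]
    simp only [Polynomial.eval_mul, Polynomial.eval_C, Polynomial.eval_pow,
      Polynomial.eval_add, Polynomial.eval_one, Polynomial.eval_X, Function.comp]
    refine (ContinuousLinearMap.le_opNorm _ _).trans ?_
    have h0 := hB0 z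
    refine mul_le_mul ((hCn _).trans ?_) (hS' θ z) (norm_nonneg _) (by positivity)
    gcongr
    exact hS θ z
  · rw [hsum]
    exact (hN.diff _).hasFDerivAt.comp_hasDerivAt θ (hasDerivAt_SS hi Fa Za θ z)

theorem fderiv_comp_SS (hi : I → Prop) [DecidablePred hi] {Fa Za : I → E → ℝ}
    (nF : ∀ α, Nice (Fa α)) (nZ : ∀ α, Nice (Za α)) {ψ : (I → ℝ) → ℝ} (hψ : Nice ψ)
    (θ : ℝ) (z w : E) :
    fderiv ℝ (fun z => ψ (SS hi Fa Za θ z)) z w =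
      ∑ β, (if hi β then Real.cos θ * fderiv ℝ (Fa β) z w + Real.sin θ * fderiv ℝ (Za β) z w
        else fderiv ℝ (Fa β) z w) * pd β ψ (SS hi Fa Za θ z) := by
  have hS := nice_SS hi nF nZ θ
  rw [fderiv_fun_comp z (hψ.diff _) (hS.diff z), ContinuousLinearMap.comp_apply, clm_pi_sum]
  refine Finset.sum_congr rfl fun β _ => ?_
  rw [smul_eq_mul, ← pd]
  congr 1
  have h1 : fderiv ℝ (SS hi Fa Za θ) z w β = fderiv ℝ (fun z => SS hi Fa Za θ z β) z w := by
    rw [fderiv_apply (hS.diff z)]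
    rfl
  rw [h1]
  by_cases h : hi β
  · simp only [SS, if_pos h]
    rw [fderiv_fun_add (((nF β).diff z).const_mul _) (((nZ β).diff z).const_mul _),
      fderiv_const_mul ((nF β).diff z), fderiv_const_mul ((nZ β).diff z)]
    simp
  · simp only [SS, if_neg h]

theorem abs_bound {J : Type*} [Fintype J] {μ : Measure E} [IsProbabilityMeasure μ] (hμ : Mom μ)
    (hi : I → Prop)
    [DecidablePred hi] {Fa Za : I → E → ℝ}
    (nF : ∀ α, Nice (Fa α)) (nZ : ∀ α, Nice (Za α)) {φ : (I → ℝ) → ℝ} (hφ : ContDiff ℝ 2 φ) {M : ℝ}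
    (hM : ∀ u, ‖iteratedFDeriv ℝ 2 φ u‖ ≤ M)
    (e : I → E) (x : J → E) (L : I → ℝ) (hL : ∀ α, 1 ≤ L α) (DF : I → J → E → ℝ)
    (nDF : ∀ α i, Nice (DF α i)) (cov m V : I → I → ℝ)
    (eF : ∀ α β z, fderiv ℝ (Fa β) z (e α) = 0)
    (eZ : ∀ α β z, fderiv ℝ (Za β) z (e α) = cov α β)
    (xF : ∀ i β z, fderiv ℝ (Fa β) z (x i) = DF β i z)
    (xZ : ∀ i β z, fderiv ℝ (Za β) z (x i) = 0)
    (hZ : ∀ α f, Nice f → ∫ z, Za α z * f z ∂μ = ∫ z, fderiv ℝ f z (e α) ∂μ)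
    (hF : ∀ α f, Nice f →
      L α * ∫ z, Fa α z * f z ∂μ = ∫ z, ∑ i, DF α i z * fderiv ℝ f z (x i) ∂μ)
    (hm1 : ∀ α β, hi α → hi β → L α * cov α β = m α β)
    (hm2 : ∀ α β, hi α → ¬ hi β → m α β = 0)
    (hV : ∀ α β, ∫ z, |∑ i, DF α i z * DF β i z - m α β| ∂μ ≤ V α β) :
    |(∫ z, φ (SS hi Fa Za 0 z) ∂μ) - ∫ z, φ (SS hi Fa Za (Real.pi / 2) z) ∂μ| ≤
      2 * M * ∑ α, ∑ β, if hi α then V α β else 0 := by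
  have hM0 : 0 ≤ M := (norm_nonneg _).trans (hM 0)
  have hV0 : ∀ α β, 0 ≤ V α β := fun α β =>
    (integral_nonneg fun z => abs_nonneg _).trans (hV α β)
  set T := ∑ α, ∑ β, if hi α then V α β else 0 with hT
  have hT0 : 0 ≤ T := Finset.sum_nonneg fun α _ => Finset.sum_nonneg fun β _ => by
    split_ifs
    · exact hV0 α β
    · exact le_rfl
  have main : ∀ θ, ‖∫ z, ∑ α, SS' hi Fa Za θ z α * pd α φ (SS hi Fa Za θ z) ∂μ‖ ≤ M * T := by
    intro θ
    have hS := nice_SS hi nF nZ θ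
    have nψ : ∀ α, Nice (fun z => pd α φ (SS hi Fa Za θ z)) := fun α => (nice_pd hφ hM α).comp hS
    have cψ : ∀ α β, Continuous (fun z => pd β (pd α φ) (SS hi Fa Za θ z)) := fun α β =>
      ((nice_pd hφ hM α).cont'_apply _).comp hS.cont
    have pψ : ∀ α β, PG (fun z => pd β (pd α φ) (SS hi Fa Za θ z)) := fun α β =>
      ((nice_pd hφ hM α).pg'_apply _).comp hS.pg
    have iψ : ∀ α β, Integrable (fun z => pd β (pd α φ) (SS hi Fa Za θ z)) μ := fun α β =>
      hμ.integrable (cψ α β) (pψ α β)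
    have nΓ : ∀ α β, Nice (fun z => ∑ i, DF α i z * DF β i z) := fun α β =>
      Nice.sum _ fun i _ => (nDF α i).mul (nDF β i)
    have iΓ : ∀ α β, Integrable
        (fun z => (∑ i, DF α i z * DF β i z) * pd β (pd α φ) (SS hi Fa Za θ z)) μ := fun α β =>
      hμ.integrable ((nΓ α β).cont.mul (cψ α β)) ((nΓ α β).pg.mul (pψ α β))
    rw [integral_finsetSum]
    swap
    · intro α _
      have := (nice_SS'_apply hi nF nZ θ α).mul (nψ α)
      exact hμ.integrable this.cont this.pg
    rw [hT, Finset.mul_sum]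
    refine (norm_sum_le _ _).trans (Finset.sum_le_sum fun α _ => ?_)
    by_cases hα : hi α
    swap
    · simp [SS', hα]
    simp only [SS', if_pos hα]
    have hLα : 0 < L α := lt_of_lt_of_le one_pos (hL α)
    -- split
    have s1 : ∫ z, (-Real.sin θ * Fa α z + Real.cos θ * Za α z) * pd α φ (SS hi Fa Za θ z) ∂μ =
        -Real.sin θ * (∫ z, Fa α z * pd α φ (SS hi Fa Za θ z) ∂μ) +
          Real.cos θ * ∫ z, Za α z * pd α φ (SS hi Fa Za θ z) ∂μ := by
      rw [← integral_const_mul, ← integral_const_mul, ← integral_add]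
      · congr 1; funext z; ring
      · have := (nF α).mul (nψ α)
        exact (hμ.integrable this.cont this.pg).const_mul _
      · have := (nZ α).mul (nψ α)
        exact (hμ.integrable this.cont this.pg).const_mul _
    have s2 : ∫ z, Za α z * pd α φ (SS hi Fa Za θ z) ∂μ =
        ∑ β, (if hi β then Real.sin θ * cov α β else 0) *
          ∫ z, pd β (pd α φ) (SS hi Fa Za θ z) ∂μ := by
      rw [hZ α _ (nψ α)]
      simp only [fderiv_comp_SS hi nF nZ (nice_pd hφ hM α), eF, eZ, mul_zero, zero_add]
      rw [integral_finsetSum _ fun β _ => (iψ α β).const_mul _]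
      simp only [integral_const_mul]
    have s3 : L α * ∫ z, Fa α z * pd α φ (SS hi Fa Za θ z) ∂μ =
        ∑ β, (if hi β then Real.cos θ else 1) *
          ∫ z, (∑ i, DF α i z * DF β i z) * pd β (pd α φ) (SS hi Fa Za θ z) ∂μ := by
      rw [hF α _ (nψ α)]
      simp only [fderiv_comp_SS hi nF nZ (nice_pd hφ hM α), xF, xZ, mul_zero, add_zero]
      have : ∀ z, ∑ i, DF α i z * ∑ β, (if hi β then Real.cos θ * DF β i z else DF β i z) *
          pd β (pd α φ) (SS hi Fa Za θ z) = ∑ β, (if hi β then Real.cos θ else 1) *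
          ((∑ i, DF α i z * DF β i z) * pd β (pd α φ) (SS hi Fa Za θ z)) := by
        intro z
        simp only [Finset.mul_sum, Finset.sum_mul]
        rw [Finset.sum_comm]
        refine Finset.sum_congr rfl fun β _ => Finset.sum_congr rfl fun i _ => ?_
        split_ifs <;> ring
      simp only [this]
      rw [integral_finsetSum _ fun β _ => (iΓ α β).const_mul _]
      simp only [integral_const_mul]
    have s4 : -Real.sin θ * (∫ z, Fa α z * pd α φ (SS hi Fa Za θ z) ∂μ) +
          Real.cos θ * ∫ z, Za α z * pd α φ (SS hi Fa Za θ z) ∂μ =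
        ∑ β, (-Real.sin θ * (if hi β then Real.cos θ else 1) * (L α)⁻¹) *
          ∫ z, (∑ i, DF α i z * DF β i z - m α β) * pd β (pd α φ) (SS hi Fa Za θ z) ∂μ := by
      have : ∫ z, Fa α z * pd α φ (SS hi Fa Za θ z) ∂μ = (L α)⁻¹ *
          (L α * ∫ z, Fa α z * pd α φ (SS hi Fa Za θ z) ∂μ) := by
        field_simp
      rw [this, s2, s3, Finset.mul_sum, Finset.mul_sum, Finset.mul_sum, ← Finset.sum_add_distrib]
      refine Finset.sum_congr rfl fun β _ => ?_
      have : ∫ z, (∑ i, DF α i z * DF β i z - m α β) * pd β (pd α φ) (SS hi Fa Za θ z) ∂μ =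
          (∫ z, (∑ i, DF α i z * DF β i z) * pd β (pd α φ) (SS hi Fa Za θ z) ∂μ) -
            m α β * ∫ z, pd β (pd α φ) (SS hi Fa Za θ z) ∂μ := by
        rw [← integral_const_mul, ← integral_sub (iΓ α β) ((iψ α β).const_mul _)]
        congr 1; funext z; ring
      rw [this]
      by_cases hβ : hi β
      · simp only [if_pos hβ]
        rw [← hm1 α β hα hβ]
        field_simp
        ring
      · simp only [if_neg hβ]
        rw [hm2 α β hα hβ]
        ring
    rw [s1, s4, Finset.mul_sum]
    refine (norm_sum_le _ _).trans (Finset.sum_le_sum fun β _ => ?_)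
    rw [norm_mul]
    have c1 : ‖-Real.sin θ * (if hi β then Real.cos θ else 1) * (L α)⁻¹‖ ≤ 1 := by
      rw [norm_mul, norm_mul, norm_neg, norm_inv]
      have h1 : ‖Real.sin θ‖ ≤ 1 := Real.abs_sin_le_one _
      have h2 : ‖(if hi β then Real.cos θ else 1)‖ ≤ 1 := by
        split_ifs
        · exact Real.abs_cos_le_one _
        · simp
      have h3 : ‖L α‖⁻¹ ≤ 1 := by
        rw [Real.norm_of_nonneg hLα.le]
        exact inv_le_one_of_one_le₀ (hL α)
      exact mul_le_one₀ (mul_le_one₀ h1 (norm_nonneg _) h2) (by positivity) h3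
    have c2 : ‖∫ z, (∑ i, DF α i z * DF β i z - m α β) * pd β (pd α φ) (SS hi Fa Za θ z) ∂μ‖ ≤
        M * V α β := by
      have nΓ' : Nice (fun z => ∑ i, DF α i z * DF β i z - m α β) := by
        simpa [sub_eq_add_neg] using (nΓ α β).add (Nice.const (-(m α β)))
      have iA : Integrable (fun z => |∑ i, DF α i z * DF β i z - m α β|) μ :=
        (hμ.integrable nΓ'.cont nΓ'.pg).abs
      calc _ ≤ ∫ z, M * |∑ i, DF α i z * DF β i z - m α β| ∂μ := by
            refine norm_integral_le_of_norm_le (iA.const_mul M)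
              (Filter.Eventually.of_forall fun z => ?_)
            rw [norm_mul, mul_comm]
            exact mul_le_mul_of_nonneg_right (pd_pd_bound hφ hM α β _) (norm_nonneg _)
        _ = M * ∫ z, |∑ i, DF α i z * DF β i z - m α β| ∂μ := integral_const_mul _ _
        _ ≤ M * V α β := by gcongr; exact hV α β
    calc _ ≤ 1 * (M * V α β) := mul_le_mul c1 c2 (norm_nonneg _) zero_le_one
      _ = _ := one_mul _
  have hd := fun θ => hasDerivAt_integral hμ hi nF nZ hφ hM θ
  have h1 := (convex_univ (𝕜 := ℝ) (E := ℝ)).norm_image_sub_le_of_norm_hasDerivWithin_le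
    (f := fun θ => ∫ z, φ (SS hi Fa Za θ z) ∂μ) (x := Real.pi / 2) (y := 0)
    (fun θ _ => (hd θ).hasDerivWithinAt) (fun θ _ => main θ) (Set.mem_univ _) (Set.mem_univ _)
  rw [Real.norm_eq_abs] at h1
  refine h1.trans ?_
  have h2 : ‖(0 : ℝ) - Real.pi / 2‖ ≤ 2 := by
    rw [zero_sub, norm_neg, Real.norm_of_nonneg (by positivity)]
    linarith [Real.pi_le_four]
  calc _ ≤ M * T * 2 := by gcongr
    _ = _ := by ring

theorem integral_abs_le_sqrt_variance {Ω : Type*} [MeasurableSpace Ω] {ν : Measure Ω}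
    [IsProbabilityMeasure ν] {f : Ω → ℝ} (hf : MemLp f 2 ν) :
    ∫ x, |f x - ∫ y, f y ∂ν| ∂ν ≤ Real.sqrt (variance f ν) := by
  refine Real.le_sqrt_of_sq_le ?_
  have h1 : MemLp (fun x => |f x - ∫ y, f y ∂ν|) 2 ν := (hf.sub (memLp_const _)).abs
  have h2 := variance_nonneg (fun x => |f x - ∫ y, f y ∂ν|) ν
  rw [variance_eq_sub h1] at h2
  rw [variance_eq_integral hf.aemeasurable]
  simpa using h2

end Abstract

/-! ### The concrete setting -/

section Concrete

/-- The dot product as a continuous linear functional. -/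
def dotL {ι : Type*} [Fintype ι] (a : ι → ℝ) : (ι → ℝ) →L[ℝ] ℝ :=
  ∑ k, a k • ContinuousLinearMap.proj (R := ℝ) (φ := fun _ : ι => ℝ) k

theorem dotL_apply {ι : Type*} [Fintype ι] (a v : ι → ℝ) : dotL a v = dotp a v := by
  simp [dotL, dotp]

theorem SteinP.dotL {ι : Type*} [Fintype ι] [DecidableEq ι] (a : ι → ℝ) :
    SteinP (_root_.stdG ι) (dotL a) a := by
  have h := SteinP.sum (Mom.stdG ι) Finset.univ (fun k => (SteinP.stdG k).smul (a k))
  have h2 : ∑ k, a k • (Pi.single k 1 : ι → ℝ) = a := by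
    funext j
    simp [Finset.sum_apply, Pi.single_apply]
  rw [h2] at h
  exact h

variable (d K : ℕ)

theorem Mom.gpart : Mom (Measure.pi fun l : Fin (K + 1) => _root_.stdG (MIdx d l.1)) :=
  Mom.pi fun _ => Mom.stdG _

theorem Mom.PΩ : Mom (PΩmeas d K) := (Mom.stdG (Fin d)).prod (Mom.gpart d K)

instance PΩ_prob : IsProbabilityMeasure (PΩmeas d K) := by
  unfold PΩmeas; infer_instance

/-- The level of an index as an element of `Fin (K + 1)`. -/
abbrev lv {K : ℕ} {kl : ℕ → ℕ} (α : PIdx K kl) : Fin (K + 1) :=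
  ⟨α.1.1, by have h := (Finset.mem_Icc.mp α.1.2).2; omega⟩

/-- The linear functional `z ↦ aᵀ g_l`. -/
def ZL {K : ℕ} {kl : ℕ → ℕ} (a : (l : ℕ) → Fin (kl l) → MIdx d l → ℝ) (α : PIdx K kl) :
    PΩ d K →L[ℝ] ℝ :=
  ((dotL (ι := MIdx d (lv α).1) (a α.1.1 α.2)).comp
    (ContinuousLinearMap.proj (R := ℝ) (φ := fun l : Fin (K + 1) => MIdx d l.1 → ℝ) (lv α))).comp
    (ContinuousLinearMap.snd ℝ (Fin d → ℝ) ((l : Fin (K + 1)) → MIdx d l.1 → ℝ))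

/-- The direction dual to `ZL`. -/
def eL {K : ℕ} {kl : ℕ → ℕ} (a : (l : ℕ) → Fin (kl l) → MIdx d l → ℝ) (α : PIdx K kl) :
    PΩ d K :=
  (0, Pi.single (M := fun l : Fin (K + 1) => MIdx d l.1 → ℝ) (lv α) (a α.1.1 α.2))

theorem SteinP.ZL {K : ℕ} {kl : ℕ → ℕ} (a : (l : ℕ) → Fin (kl l) → MIdx d l → ℝ)
    (α : PIdx K kl) : SteinP (PΩmeas d K) (ZL d a α) (eL d a α) := by
  have h1 := SteinP.dotL (ι := MIdx d (lv α).1) (a α.1.1 α.2)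
  have h2 := SteinP.pi (μ := fun l : Fin (K + 1) => _root_.stdG (MIdx d l.1))
    (fun _ => Mom.stdG _) (lv α) h1
  exact SteinP.prod_right (Mom.stdG (Fin d)) (Mom.gpart d K) h2

theorem SteinP.x (i : Fin d) : SteinP (PΩmeas d K)
    ((ContinuousLinearMap.proj (R := ℝ) (φ := fun _ : Fin d => ℝ) i).comp
      (ContinuousLinearMap.fst ℝ (Fin d → ℝ) ((l : Fin (K + 1)) → MIdx d l.1 → ℝ)))
    (Pi.single i 1, 0) :=
  SteinP.prod_left (Mom.stdG (Fin d)) (Mom.gpart d K) (SteinP.stdG i)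

theorem ZL_eL {K : ℕ} {kl : ℕ → ℕ} (a : (l : ℕ) → Fin (kl l) → MIdx d l → ℝ)
    (α β : PIdx K kl) :
    ZL d a β (eL d a α) = ∫ x, chaosFn d α.1.1 (a α.1.1 α.2) x * chaosFn d β.1.1 (a β.1.1 β.2) x
      ∂(stdG (Fin d)) := by
  have h0 : ZL d a β (eL d a α) = dotp (ι := MIdx d (lv β).1) (a β.1.1 β.2)
      (Pi.single (M := fun l : Fin (K + 1) => MIdx d l.1 → ℝ) (lv α) (a α.1.1 α.2) (lv β)) := by
    exact dotL_apply _ _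
  refine h0.trans ?_
  clear h0
  by_cases h : α.1 = β.1
  · obtain ⟨l, i⟩ := α
    obtain ⟨l', j⟩ := β
    simp only at h
    subst h
    rw [chaos_inner]
    have h1 : (Pi.single (M := fun l : Fin (K + 1) => MIdx d l.1 → ℝ)
        (lv (⟨l, i⟩ : PIdx K kl)) (a l.1 i) (lv (⟨l, j⟩ : PIdx K kl))) = a l.1 i :=
      Pi.single_eq_same (M := fun l : Fin (K + 1) => MIdx d l.1 → ℝ) _ _
    refine (congrArg (dotp (ι := MIdx d l.1) (a l.1 j)) h1).trans ?_
    simp only [dotp, mul_comm]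
  · have h1 : α.1.1 ≠ β.1.1 := fun h' => h (Subtype.ext h')
    rw [chaos_inner_ne h1]
    have h2 : lv β ≠ lv α := fun h' => h1 (congrArg Fin.val h').symm
    have h3 : (Pi.single (M := fun l : Fin (K + 1) => MIdx d l.1 → ℝ)
        (lv α) (a α.1.1 α.2) (lv β)) = 0 :=
      Pi.single_eq_of_ne (M := fun l : Fin (K + 1) => MIdx d l.1 → ℝ) h2 _
    refine (congrArg (dotp (ι := MIdx d β.1.1) (a β.1.1 β.2)) h3).trans ?_
    simp [dotp]

end Concrete

/-- **Partial Gaussian Equivalence Theorem**: the abstract interpolation bound, with a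
constant depending only on `K`, `K'` and the multiplicities `k_l`. -/
theorem partial_gaussian_equivalence (K K' : ℕ) (hK : 1 ≤ K) (hK' : K' ≤ K)
    (kl : ℕ → ℕ) (hkl : ∀ l : ℕ, 1 ≤ l → l ≤ K → 1 ≤ kl l) :
    ∃ C : ℝ, 0 < C ∧
      ∀ d : ℕ, 1 ≤ d →
      ∀ a : (l : ℕ) → Fin (kl l) → MIdx d l → ℝ,
      ∀ φ : (PIdx K kl → ℝ) → ℝ, ContDiff ℝ 2 φ →
      ∀ M : ℝ, (∀ u : PIdx K kl → ℝ, ‖iteratedFDeriv ℝ 2 φ u‖ ≤ M) →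
        |(∫ ω : PΩ d K, φ (sInterp d K K' kl a ω.1 ω.2 0) ∂(PΩmeas d K)) -
            (∫ ω : PΩ d K, φ (sInterp d K K' kl a ω.1 ω.2 1) ∂(PΩmeas d K))| ≤
          C * M *
            ∑ α : PIdx K kl, ∑ β : PIdx K kl,
              (if K' < α.1.1 then
                Real.sqrt (variance
                  (gradInner d (chaosFn d α.1.1 (a α.1.1 α.2)) (chaosFn d β.1.1 (a β.1.1 β.2)))
                  (stdG (Fin d)))
              else 0) := by
  refine ⟨2, two_pos, fun d _ a φ hφ M hM => ?_⟩
  let p := ContinuousLinearMap.fst ℝ (Fin d → ℝ) ((l : Fin (K + 1)) → MIdx d l.1 → ℝ)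
  let P : PIdx K kl → MvPolynomial (Fin d) ℝ := fun α => chaosPoly d α.1.1 (a α.1.1 α.2)
  let Fa : PIdx K kl → PΩ d K → ℝ := fun α z => chaosFn d α.1.1 (a α.1.1 α.2) z.1
  let Za : PIdx K kl → PΩ d K → ℝ := fun α z => ZL d a α z
  let Γ : PIdx K kl → PIdx K kl → (Fin d → ℝ) → ℝ := fun α β =>
    gradInner d (chaosFn d α.1.1 (a α.1.1 α.2)) (chaosFn d β.1.1 (a β.1.1 β.2))
  have hFa : ∀ α, Fa α = fun z => MvPolynomial.eval (p z) (P α) := by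
    intro α
    simp only [Fa, chaosFn_eq]
    rfl
  have nP : ∀ Q : MvPolynomial (Fin d) ℝ, Nice (fun z => MvPolynomial.eval (p z) Q) :=
    fun Q => (Nice.mvpoly Q).comp (Nice.clm p)
  have nF : ∀ α, Nice (Fa α) := fun α => by rw [hFa]; exact nP _
  have nZ : ∀ α, Nice (Za α) := fun α => Nice.clm _
  have hfd : ∀ (Q : MvPolynomial (Fin d) ℝ) (z w : PΩ d K),
      fderiv ℝ (fun z => MvPolynomial.eval (p z) Q) z w =
        fderiv ℝ (fun x => MvPolynomial.eval x Q) (p z) (p w) := by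
    intro Q z w
    rw [fderiv_fun_comp z ((Nice.mvpoly Q).diff _) p.differentiableAt, p.fderiv]
    rfl
  have hZd : ∀ (α : PIdx K kl) (z w : PΩ d K), fderiv ℝ (Za α) z w = ZL d a α w := by
    intro α z w
    exact congrArg (fun T => T w) ((ZL d a α).fderiv (x := z))
  have hΓn : ∀ α β, Nice (Γ α β) := by
    intro α β
    have : Γ α β = fun x => ∑ i, MvPolynomial.eval x (MvPolynomial.pderiv i (P α)) *
        MvPolynomial.eval x (MvPolynomial.pderiv i (P β)) := by
      funext x; exact gradInner_eq _ _ _ _ x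
    rw [this]
    exact Nice.sum _ fun i _ => (Nice.mvpoly _).mul (Nice.mvpoly _)
  have key := abs_bound (Mom.PΩ d K) (fun α : PIdx K kl => K' < α.1.1) nF nZ hφ hM
    (eL d a) (fun i : Fin d => (Pi.single i 1, 0)) (fun α => (α.1.1 : ℝ))
    (fun α => by exact_mod_cast (Finset.mem_Icc.mp α.1.2).1)
    (fun α i z => MvPolynomial.eval (p z) (MvPolynomial.pderiv i (P α)))
    (fun α i => nP _)
    (fun α β => ZL d a β (eL d a α))
    (fun α β => ∫ x, Γ α β x ∂(stdG (Fin d)))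
    (fun α β => Real.sqrt (variance (Γ α β) (stdG (Fin d))))
    (fun α β z => by
      rw [hFa, hfd]
      have : p (eL d a α) = 0 := rfl
      rw [this, map_zero])
    (fun α β z => hZd _ _ _)
    (fun i β z => by
      rw [hFa, hfd]
      exact fderiv_mvpoly _ _ _)
    (fun i β z => by
      rw [hZd]
      simp [ZL])
    (fun α f hf => SteinP.ZL d a α f hf)
    (fun α f hf => by
      rw [hFa]
      exact eig_ibp (Mom.PΩ d K) p (fun i => (Pi.single i 1, 0)) (fun i => rfl)
        (fun i => SteinP.x d K i) (chaosPoly_eig d α.1.1 (a α.1.1 α.2)) hf)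
    (fun α β _ _ => by
      rw [ZL_eL]
      exact (grad_integral _ _ _ _).symm)
    (fun α β h1 h2 => by
      have h3 : α.1.1 ≠ β.1.1 := by omega
      have := grad_integral α.1.1 β.1.1 (a α.1.1 α.2) (a β.1.1 β.2)
      rw [chaos_inner_ne h3, mul_zero] at this
      exact this)
    (fun α β => by
      have h1 : MemLp (Γ α β) 2 (stdG (Fin d)) := by
        rw [memLp_two_iff_integrable_sq (hΓn α β).cont.aestronglyMeasurable]
        have := (hΓn α β).mul (hΓn α β)
        simpa [sq] using (Mom.stdG (Fin d)).integrable this.cont this.pg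
      refine le_trans (le_of_eq ?_) (integral_abs_le_sqrt_variance h1)
      have h2 := integral_fun_fst (μ := stdG (Fin d))
        (ν := Measure.pi fun l : Fin (K + 1) => stdG (MIdx d l.1))
        (fun x => |Γ α β x - ∫ y, Γ α β y ∂(stdG (Fin d))|)
      simp only [probReal_univ, one_smul] at h2
      rw [← h2]
      refine integral_congr_ae (Filter.Eventually.of_forall fun z => ?_)
      have h3 : Γ α β z.1 = ∑ i, MvPolynomial.eval (p z) (MvPolynomial.pderiv i (P α)) *
        MvPolynomial.eval (p z) (MvPolynomial.pderiv i (P β)) := gradInner_eq _ _ _ _ z.1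
      simp only [h3])
  have hZa : ∀ (α : PIdx K kl) (z : PΩ d K), Za α z = dotp (a α.1.1 α.2)
      (z.2 ⟨α.1.1, by have h := (Finset.mem_Icc.mp α.1.2).2; omega⟩) := by
    intro α z
    exact dotL_apply _ _
  have e0 : ∀ ω : PΩ d K, sInterp d K K' kl a ω.1 ω.2 0 =
      SS (fun α : PIdx K kl => K' < α.1.1) Fa Za 0 ω := by
    intro ω
    funext α
    simp only [sInterp, SS, ← not_lt]
    by_cases h : K' < α.1.1
    · simp [h, Fa, chaosFn]
    · simp [h, Fa, chaosFn]
  have e1 : ∀ ω : PΩ d K, sInterp d K K' kl a ω.1 ω.2 1 =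
      SS (fun α : PIdx K kl => K' < α.1.1) Fa Za (Real.pi / 2) ω := by
    intro ω
    funext α
    simp only [sInterp, SS, ← not_lt]
    by_cases h : K' < α.1.1
    · simp [h, hZa]
    · simp [h, Fa, chaosFn]
  simp only [e0, e1]
  exact key
end
end

section
/- Excess-kurtosis bounds via tensor contractions for Wiener chaos (Lemma B.2). Fix an integer k ≥ 1. There exists a constant C > 0 depending only on k such that for every d ≥ 1 and every symmetric tensor T ∈ (ℝ^d)^{⊗k}, setting Q := √(k!)·⟨T, H_k(x)⟩ with x ~ N(0,I_d), one has C^{−1}·max_{1≤r≤k−1}‖T ⊗_r T‖_F² ≤ E[Q⁴] − 3(E[Q²])² ≤ C·max_{1≤r≤k−1}‖T ⊗_r T‖_F², where the maximum over the empty range (k = 1) is interpreted as 0. -/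
/-!
Excess-kurtosis bounds via tensor contractions for Wiener chaos (Lemma B.2).
-/

noncomputable section

open MeasureTheory ProbabilityTheory

/-- `typeOf i` records how many times each value of `Fin d` occurs in the tuple `i`. -/
def typeOf {k d : ℕ} (i : Fin k → Fin d) : Fin d → ℕ :=
  fun a => (Finset.univ.filter fun t => i t = a).card

/-- The order-`k` Hermite tensor `H_k(x) = ι(h_k(x))`, with entry
`(k!/(k₁!⋯k_d!))^{-1/2} ∏ₐ He_{kₐ}(xₐ)` at a tuple of type `(k₁,…,k_d)`. -/
def Htensor (d k : ℕ) (x : Fin d → ℝ) : (Fin k → Fin d) → ℝ :=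
  fun i =>
    Real.sqrt ((∏ a, (Nat.factorial (typeOf i a) : ℝ)) / (Nat.factorial k : ℝ)) *
      ∏ a, He (typeOf i a) (x a)

/-- Combine a tuple of `k - r` free indices with a tuple of `r` contracted indices into
a tuple of `k` indices (free indices first). -/
def splitIdx (d k r : ℕ) (i : Fin (k - r) → Fin d) (a : Fin r → Fin d) : Fin k → Fin d :=
  fun t => if h : (t : ℕ) < k - r then i ⟨t, h⟩ else a ⟨(t : ℕ) - (k - r), by omega⟩

/-- The squared Frobenius norm `‖S ⊗_r T‖_F²` of the contraction of two symmetric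
`k`-tensors over `r` indices. -/
def contrNormSq (d k r : ℕ) (S T : (Fin k → Fin d) → ℝ) : ℝ :=
  ∑ ij : (Fin (k - r) → Fin d) × (Fin (k - r) → Fin d),
    (∑ a : Fin r → Fin d, S (splitIdx d k r ij.1 a) * T (splitIdx d k r ij.2 a)) ^ 2

/-- A tensor is symmetric if it is invariant under permutation of its indices. -/
def SymTensor (d k : ℕ) (T : (Fin k → Fin d) → ℝ) : Prop :=
  ∀ (π : Equiv.Perm (Fin k)) (i : Fin k → Fin d), T (i ∘ π) = T i

/-- The chaos variable `Q = √(k!)·⟨T, H_k(x)⟩`. -/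
def Qchaos (d k : ℕ) (T : (Fin k → Fin d) → ℝ) (x : Fin d → ℝ) : ℝ :=
  Real.sqrt (Nat.factorial k) * ∑ i : Fin k → Fin d, T i * Htensor d k x i


/-- Gaussian moments recursion. -/
theorem gauss_integrable_pow (n : ℕ) : Integrable (fun x : ℝ => x ^ n) (gaussianReal 0 1) := by
  have h := (memLp_id_gaussianReal (μ := 0) (v := 1) (n : NNReal)).integrable_norm_pow'
  have h2 : Integrable (fun x : ℝ => ‖x ^ n‖) (gaussianReal 0 1) := by
    simpa [norm_pow] using h
  exact (integrable_norm_iff (by fun_prop)).1 h2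

theorem gauss_pdf_integrable_pow (n : ℕ) :
    Integrable (fun x : ℝ => x ^ n * gaussianPDFReal 0 1 x) := by
  have h := gauss_integrable_pow n
  rw [gaussianReal_of_var_ne_zero _ one_ne_zero] at h
  rw [integrable_withDensity_iff (measurable_gaussianPDF 0 1)
    (Filter.Eventually.of_forall fun x => by simp [gaussianPDF])] at h
  simpa [gaussianPDF, ENNReal.toReal_ofReal (gaussianPDFReal_nonneg 0 1 _)] using h

theorem gauss_pdf_deriv (x : ℝ) :
    HasDerivAt (gaussianPDFReal 0 1) (-x * gaussianPDFReal 0 1 x) x := by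
  unfold gaussianPDFReal
  have : HasDerivAt (fun x : ℝ => -(x - 0) ^ 2 / (2 * ((1 : NNReal) : ℝ))) (-x) x := by
    have := (((hasDerivAt_id x).sub_const 0).pow 2).neg.div_const (2 * ((1 : NNReal) : ℝ))
    refine this.congr_deriv ?_
    simp
    ring
  have := this.exp.const_mul ((Real.sqrt (2 * Real.pi * ((1 : NNReal) : ℝ)))⁻¹)
  refine this.congr_deriv ?_
  ring

theorem gauss_moment_succ (n : ℕ) :
    ∫ x, x ^ (n + 1) ∂(gaussianReal 0 1) = n * ∫ x, x ^ (n - 1) ∂(gaussianReal 0 1) := by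
  rw [integral_gaussianReal_eq_integral_smul one_ne_zero,
    integral_gaussianReal_eq_integral_smul one_ne_zero]
  have key := integral_mul_deriv_eq_deriv_mul_of_integrable (u := fun x : ℝ => x ^ n)
    (v := gaussianPDFReal 0 1) (u' := fun x => n * x ^ (n - 1))
    (v' := fun x => -x * gaussianPDFReal 0 1 x)
    (fun x _ => by simpa using hasDerivAt_pow n x) (fun x _ => gauss_pdf_deriv x)
    (by
      have := (gauss_pdf_integrable_pow (n + 1)).neg
      refine this.congr (Filter.Eventually.of_forall fun x => ?_)
      simp; ring)
    (by
      have := (gauss_pdf_integrable_pow (n - 1)).const_mul (n : ℝ)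
      refine this.congr (Filter.Eventually.of_forall fun x => ?_)
      simp; ring)
    (gauss_pdf_integrable_pow n)
  have e1 : ∫ x, x ^ n * (-x * gaussianPDFReal 0 1 x)
      = - ∫ x, gaussianPDFReal 0 1 x • x ^ (n + 1) := by
    rw [← integral_neg]; congr 1; ext x; simp; ring
  have e2 : ∫ x, (n * x ^ (n - 1)) * gaussianPDFReal 0 1 x
      = n * ∫ x, gaussianPDFReal 0 1 x • x ^ (n - 1) := by
    rw [← integral_const_mul]; congr 1; ext x; simp; ring
  linarith [key, e1, e2]

theorem stdG_integrable {d : ℕ} (P : MvPolynomial (Fin d) ℝ) :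
    Integrable (fun x => MvPolynomial.eval x P) (stdG (Fin d)) := by
  induction P using MvPolynomial.induction_on' with
  | monomial u a =>
    simp only [MvPolynomial.eval_monomial]
    refine Integrable.const_mul ?_ a
    simp only [Finsupp.prod_fintype _ _ (fun i => pow_zero _)]
    exact Integrable.fintype_prod (f := fun i (y : ℝ) => y ^ u i) (fun i => gauss_integrable_pow _)
  | add p q hp hq =>
    simp only [map_add]
    exact hp.add hq

/-- Gaussian expectation of a polynomial. -/
def EG (d : ℕ) : MvPolynomial (Fin d) ℝ →ₗ[ℝ] ℝ where
  toFun P := ∫ x, MvPolynomial.eval x P ∂(stdG (Fin d))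
  map_add' P Q := by
    simp only [map_add]
    exact integral_add (stdG_integrable P) (stdG_integrable Q)
  map_smul' c P := by
    simp only [MvPolynomial.smul_eval, RingHom.id_apply, smul_eq_mul]
    exact integral_const_mul _ _

theorem EG_one (d : ℕ) : EG d 1 = 1 := by
  have : IsProbabilityMeasure (stdG (Fin d)) := by unfold stdG; infer_instance
  simp [EG]

theorem EG_monomial (d : ℕ) (u : Fin d →₀ ℕ) (a : ℝ) :
    EG d (MvPolynomial.monomial u a) = a * ∏ i, ∫ x, x ^ u i ∂(gaussianReal 0 1) := by
  simp only [EG, LinearMap.coe_mk, AddHom.coe_mk, MvPolynomial.eval_monomial]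
  rw [integral_const_mul]
  simp only [Finsupp.prod_fintype _ _ (fun i => pow_zero _)]
  rw [stdG, integral_fintype_prod_eq_prod (fun i (y : ℝ) => y ^ u i)]

theorem EG_ibp (d : ℕ) (a : Fin d) (P : MvPolynomial (Fin d) ℝ) :
    EG d (MvPolynomial.X a * P) = EG d (MvPolynomial.pderiv a P) := by
  induction P using MvPolynomial.induction_on' with
  | monomial u c =>
    rw [MvPolynomial.X, MvPolynomial.monomial_mul, MvPolynomial.pderiv_monomial, EG_monomial,
      EG_monomial]
    rw [← Finset.mul_prod_erase _ _ (Finset.mem_univ a),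
      ← Finset.mul_prod_erase Finset.univ
        (fun i => ∫ x, x ^ ((u - Finsupp.single a 1 : Fin d →₀ ℕ) i) ∂(gaussianReal 0 1)) (Finset.mem_univ a)]
    have h : ∏ x ∈ Finset.univ.erase a, ∫ y, y ^ ((Finsupp.single a 1 + u : Fin d →₀ ℕ) x) ∂(gaussianReal 0 1)
      = ∏ x ∈ Finset.univ.erase a, ∫ y, y ^ ((u - Finsupp.single a 1 : Fin d →₀ ℕ) x) ∂(gaussianReal 0 1) := by
      refine Finset.prod_congr rfl fun x hx => ?_
      have : x ≠ a := (Finset.mem_erase.1 hx).1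
      simp [Finsupp.single_apply, this.symm]
    rw [h]
    have h2 := gauss_moment_succ (u a)
    simp only [Finsupp.coe_add, Pi.add_apply, Finsupp.single_eq_same, Finsupp.coe_tsub,
      Pi.sub_apply]
    rw [add_comm 1 (u a), h2]
    ring
  | add p q hp hq => simp [mul_add, hp, hq]

set_option linter.unusedSectionVars false
set_option linter.unusedSimpArgs false

section Combi

variable {σ : Type*} [Fintype σ] [DecidableEq σ]

/-- Sum of `f` over all `n`-tuples, seen as multisets. -/
def Sm (n : ℕ) (f : Multiset σ → ℝ) : ℝ :=
  ∑ i : Fin n → σ, f (Multiset.map i Finset.univ.val)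

theorem Sm_zero (f : Multiset σ → ℝ) : Sm 0 f = f 0 := by
  simp [Sm]

theorem ms_cons (n : ℕ) (a : σ) (i : Fin n → σ) :
    Multiset.map (Fin.cons a i : Fin (n + 1) → σ) Finset.univ.val
      = a ::ₘ Multiset.map i Finset.univ.val := by
  rw [Fin.univ_succ]
  simp [Multiset.map_map, Function.comp_def]

theorem Sm_succ (n : ℕ) (f : Multiset σ → ℝ) :
    Sm (n + 1) f = ∑ a, Sm n (fun s => f (a ::ₘ s)) := by
  unfold Sm
  rw [← (Fin.consEquiv (fun _ : Fin (n + 1) => σ)).sum_comp, Fintype.sum_prod_type]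
  refine Finset.sum_congr rfl fun a _ => Finset.sum_congr rfl fun i _ => ?_
  exact congrArg f (ms_cons n a i)

theorem Sm_add (n : ℕ) (f g : Multiset σ → ℝ) :
    Sm n (fun s => f s + g s) = Sm n f + Sm n g := Finset.sum_add_distrib

theorem Sm_mul_left (n : ℕ) (c : ℝ) (f : Multiset σ → ℝ) :
    Sm n (fun s => c * f s) = c * Sm n f := (Finset.mul_sum _ _ _).symm

theorem Sm_mul_right (n : ℕ) (c : ℝ) (f : Multiset σ → ℝ) :
    Sm n (fun s => f s * c) = Sm n f * c := (Finset.sum_mul _ _ _).symm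

theorem Sm_fsum {ι : Type*} (t : Finset ι) (n : ℕ) (f : ι → Multiset σ → ℝ) :
    Sm n (fun s => ∑ a ∈ t, f a s) = ∑ a ∈ t, Sm n (f a) := Finset.sum_comm

theorem Sm_comm (m n : ℕ) (f : Multiset σ → Multiset σ → ℝ) :
    Sm m (fun s => Sm n (fun t => f s t)) = Sm n (fun t => Sm m (fun s => f s t)) :=
  Finset.sum_comm

theorem Sm_congr {n : ℕ} {f g : Multiset σ → ℝ} (h : ∀ s, s.card = n → f s = g s) :
    Sm n f = Sm n g := Finset.sum_congr rfl fun i _ => h _ (by simp)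

theorem Sm_le {n : ℕ} {f g : Multiset σ → ℝ} (h : ∀ s, s.card = n → f s ≤ g s) :
    Sm n f ≤ Sm n g := Finset.sum_le_sum fun i _ => h _ (by simp)

theorem Sm_nonneg {n : ℕ} {f : Multiset σ → ℝ} (h : ∀ s, s.card = n → 0 ≤ f s) :
    0 ≤ Sm n f := Finset.sum_nonneg fun i _ => h _ (by simp)

theorem Sm_zero_fun (n : ℕ) : Sm n (fun _ : Multiset σ => (0 : ℝ)) = 0 := by simp [Sm]

theorem Sm_count (n : ℕ) (a : σ) (f : Multiset σ → ℝ) :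
    Sm (n + 1) (fun s => (s.count a : ℝ) * f s) = (n + 1 : ℝ) * Sm n (fun s => f (a ::ₘ s)) := by
  induction n generalizing f with
  | zero =>
    rw [Sm_succ]
    simp only [Sm_zero]
    rw [Finset.sum_eq_single a]
    · simp
    · intro b _ hb
      simp [Multiset.count_cons, hb.symm]
    · simp
  | succ n ih =>
    rw [Sm_succ]
    have : ∀ b, Sm (n + 1) (fun s => ((b ::ₘ s).count a : ℝ) * f (b ::ₘ s))
        = (n + 1 : ℝ) * Sm n (fun s => f (b ::ₘ a ::ₘ s))
          + (if a = b then Sm (n + 1) (fun s => f (b ::ₘ s)) else 0) := by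
      intro b
      rw [← ih (fun s => f (b ::ₘ s))]
      split_ifs with h
      · rw [← Sm_add]
        refine Sm_congr fun s _ => ?_
        simp [Multiset.count_cons, h]
        ring
      · simp [Multiset.count_cons, h]
    simp only [this]
    rw [Finset.sum_add_distrib, ← Finset.mul_sum]
    simp only [Finset.sum_ite_eq, Finset.mem_univ, if_true]
    rw [Sm_succ n (fun s => f (a ::ₘ s))]
    simp only [Multiset.cons_swap a]
    push_cast
    ring

/-- Sum over splittings of a multiset. -/
def AD {M : Type*} [AddCommMonoid M] (s : Multiset σ) (φ : Multiset σ → Multiset σ → M) : M :=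
  ((Multiset.antidiagonal s).map (fun p => φ p.1 p.2)).sum

theorem AD_zero {M : Type*} [AddCommMonoid M] (φ : Multiset σ → Multiset σ → M) :
    AD 0 φ = φ 0 0 := by simp [AD]

theorem AD_cons {M : Type*} [AddCommMonoid M] (a : σ) (s : Multiset σ)
    (φ : Multiset σ → Multiset σ → M) :
    AD (a ::ₘ s) φ = AD s (fun u v => φ u (a ::ₘ v)) + AD s (fun u v => φ (a ::ₘ u) v) := by
  simp [AD, Multiset.map_map, Function.comp_def]

theorem AD_map {M N : Type*} [AddCommMonoid M] [AddCommMonoid N] (g : M →+ N) (s : Multiset σ)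
    (φ : Multiset σ → Multiset σ → M) :
    g (AD s φ) = AD s (fun u v => g (φ u v)) := by
  simp [AD, map_multiset_sum, Multiset.map_map, Function.comp_def]

theorem AD_congr {M : Type*} [AddCommMonoid M] {s : Multiset σ}
    {φ ψ : Multiset σ → Multiset σ → M} (h : ∀ u v, u + v = s → φ u v = ψ u v) :
    AD s φ = AD s ψ := by
  unfold AD
  congr 1
  refine Multiset.map_congr rfl fun p hp => h _ _ (Multiset.mem_antidiagonal.1 hp)

theorem AD_sum_add {M : Type*} [AddCommMonoid M] (s : Multiset σ)
    (φ ψ : Multiset σ → Multiset σ → M) :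
    AD s (fun u v => φ u v + ψ u v) = AD s φ + AD s ψ := by simp [AD]

theorem AD_zero_fun {M : Type*} [AddCommMonoid M] (s : Multiset σ) :
    AD s (fun _ _ => (0 : M)) = 0 := by simp [AD]

theorem AD_mul_left (s : Multiset σ) (c : ℝ) (φ : Multiset σ → Multiset σ → ℝ) :
    AD s (fun u v => c * φ u v) = c * AD s φ :=
  (AD_map (AddMonoidHom.mulLeft c) s φ).symm

theorem AD_add {M : Type*} [AddCommMonoid M] (s t : Multiset σ)
    (φ : Multiset σ → Multiset σ → M) :
    AD (s + t) φ = AD s (fun a b => AD t (fun c e => φ (a + c) (b + e))) := by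
  induction s using Multiset.induction_on generalizing φ with
  | empty => simp [AD_zero]
  | cons a s ih =>
    rw [Multiset.cons_add, AD_cons, AD_cons, ih, ih]
    simp only [Multiset.cons_add]

theorem AD_sq_le (s : Multiset σ) (φ : Multiset σ → Multiset σ → ℝ) :
    (AD s φ) ^ 2 ≤ 2 ^ s.card * AD s (fun u v => φ u v ^ 2) := by
  induction s using Multiset.induction_on generalizing φ with
  | empty => simp [AD_zero]
  | cons a s ih =>
    rw [AD_cons, AD_cons, Multiset.card_cons, pow_succ (2 : ℝ)]
    have h1 := ih (fun u v => φ u (a ::ₘ v))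
    have h2 := ih (fun u v => φ (a ::ₘ u) v)
    have h3 := sq_nonneg (AD s (fun u v => φ u (a ::ₘ v)) - AD s (fun u v => φ (a ::ₘ u) v))
    nlinarith

theorem Sm_AD (n : ℕ) (φ : Multiset σ → Multiset σ → ℝ) :
    Sm n (fun s => AD s φ) = ∑ ij ∈ Finset.HasAntidiagonal.antidiagonal n,
      (n.choose ij.1 : ℝ) * Sm ij.1 (fun u => Sm ij.2 (fun v => φ u v)) := by
  induction n generalizing φ with
  | zero => simp [Sm_zero, AD_zero]
  | succ n ih =>
    rw [Finset.sum_antidiagonal_choose_succ_mul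
      (fun i j => Sm i (fun u => Sm j (fun v => φ u v))), Sm_succ]
    simp only [AD_cons, Sm_add, ih]
    rw [Finset.sum_add_distrib, Finset.sum_comm, Finset.sum_comm (s := Finset.univ)]
    congr 1
    · refine Finset.sum_congr rfl fun ij _ => ?_
      rw [← Finset.mul_sum, ← Sm_fsum]
      simp only [Sm_succ]
    · refine Finset.sum_congr rfl fun ij hij => ?_
      rw [← Finset.mul_sum, Sm_succ]
      rw [Finset.HasAntidiagonal.mem_antidiagonal] at hij
      rw [← Nat.choose_symm_of_eq_add hij.symm]

/-- splitting off pieces of prescribed size. -/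
theorem Sm_AD_card (p q : ℕ) (φ : Multiset σ → Multiset σ → ℝ) :
    Sm (p + q) (fun s => AD s (fun u v => if u.card = p then φ u v else 0))
      = ((p + q).choose p : ℝ) * Sm p (fun u => Sm q (fun v => φ u v)) := by
  rw [Sm_AD, Finset.sum_eq_single (p, q)]
  · congr 1
    refine Sm_congr fun u hu => ?_
    simp [hu]
  · rintro ⟨i, j⟩ hij hne
    rw [Finset.HasAntidiagonal.mem_antidiagonal] at hij
    have : i ≠ p := by
      rintro rfl
      apply hne
      simp only [Prod.mk.injEq, true_and]
      simpa using hij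
    have h0 : Sm i (fun u => Sm j (fun v => if u.card = p then φ u v else 0)) = 0 := by
      rw [← Sm_zero_fun (σ := σ) i]
      refine Sm_congr fun u hu => ?_
      simp [hu, this, Sm_zero_fun]
    simp only [h0, mul_zero]
  · simp

end Combi

section Poly

open MvPolynomial

variable {σ : Type*} [Fintype σ] [DecidableEq σ]

theorem pd_comm (a b : σ) (P : MvPolynomial σ ℝ) :
    pderiv a (pderiv b P) = pderiv b (pderiv a P) := by
  induction P using MvPolynomial.induction_on with
  | C c => simp
  | add p q hp hq => simp [hp, hq]
  | mul_X p i hp =>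
    simp only [pderiv_mul, map_add, hp, pderiv_X]
    have h1 : pderiv a (Pi.single (M := fun _ => MvPolynomial σ ℝ) b 1 i) = 0 := by
      by_cases h : i = b
      · subst h; simp
      · simp [h]
    have h2 : pderiv b (Pi.single (M := fun _ => MvPolynomial σ ℝ) a 1 i) = 0 := by
      by_cases h : i = a
      · subst h; simp
      · simp [h]
    rw [h1, h2]
    ring

instance pd_leftComm : LeftCommutative (fun (a : σ) (P : MvPolynomial σ ℝ) => pderiv a P) :=
  ⟨fun a b P => pd_comm a b P⟩

/-- Iterated partial derivative along a multiset of directions. -/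
def Dm (s : Multiset σ) (P : MvPolynomial σ ℝ) : MvPolynomial σ ℝ :=
  s.foldr (fun a P => pderiv a P) P

theorem Dm_zero (P : MvPolynomial σ ℝ) : Dm 0 P = P := by simp [Dm]

theorem Dm_cons (a : σ) (s : Multiset σ) (P : MvPolynomial σ ℝ) :
    Dm (a ::ₘ s) P = pderiv a (Dm s P) := by simp [Dm]

theorem Dm_pderiv (a : σ) (s : Multiset σ) (P : MvPolynomial σ ℝ) :
    Dm s (pderiv a P) = pderiv a (Dm s P) := by
  induction s using Multiset.induction_on with
  | empty => simp [Dm_zero]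
  | cons b s ih => rw [Dm_cons, Dm_cons, ih, pd_comm]

theorem Dm_cons' (a : σ) (s : Multiset σ) (P : MvPolynomial σ ℝ) :
    Dm (a ::ₘ s) P = Dm s (pderiv a P) := by rw [Dm_cons, Dm_pderiv]

theorem Dm_add (s : Multiset σ) (P Q : MvPolynomial σ ℝ) :
    Dm s (P + Q) = Dm s P + Dm s Q := by
  induction s using Multiset.induction_on with
  | empty => simp [Dm_zero]
  | cons b s ih => simp [Dm_cons, ih]

theorem Dm_smul (s : Multiset σ) (c : ℝ) (P : MvPolynomial σ ℝ) :
    Dm s (c • P) = c • Dm s P := by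
  induction s using Multiset.induction_on with
  | empty => simp [Dm_zero]
  | cons b s ih => simp [Dm_cons, ih]

theorem Dm_zero_poly (s : Multiset σ) : Dm s (0 : MvPolynomial σ ℝ) = 0 := by
  have := Dm_smul s 0 (0 : MvPolynomial σ ℝ)
  simpa using this

theorem Dm_mul (s : Multiset σ) (P Q : MvPolynomial σ ℝ) :
    Dm s (P * Q) = AD s (fun u v => Dm u P * Dm v Q) := by
  induction s using Multiset.induction_on with
  | empty => simp [Dm_zero, AD_zero]
  | cons b s ih =>
    rw [Dm_cons, ih, AD_cons, ← AD_sum_add]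
    have := AD_map (pderiv (R := ℝ) b).toLinearMap.toAddMonoidHom s (fun u v => Dm u P * Dm v Q)
    refine Eq.trans this ?_
    refine AD_congr fun u v _ => ?_
    simp [Dm_cons, pderiv_mul]
    ring

theorem Dm_X_mul (s : Multiset σ) (a : σ) (P : MvPolynomial σ ℝ) :
    Dm s (X a * P) = X a * Dm s P + (s.count a : ℝ) • Dm (s.erase a) P := by
  induction s using Multiset.induction_on with
  | empty => simp [Dm_zero]
  | cons b s ih =>
    rw [Dm_cons, ih, map_add, pderiv_mul, Derivation.map_smul, ← Dm_cons, ← Dm_cons]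
    by_cases h : b = a
    · subst h
      simp only [pderiv_X_self, Multiset.count_cons_self, Multiset.erase_cons_head]
      by_cases hb : b ∈ s
      · rw [Multiset.cons_erase hb]
        push_cast
        rw [add_smul]
        simp
        ring
      · simp [Multiset.count_eq_zero_of_notMem hb]
        ring
    · rw [pderiv_X_of_ne (Ne.symm h), Multiset.count_cons_of_ne (Ne.symm h),
        Multiset.erase_cons_tail _ h]
      simp

theorem Dm_one (s : Multiset σ) (hs : s ≠ 0) : Dm s (1 : MvPolynomial σ ℝ) = 0 := by
  obtain ⟨a, ha⟩ := Multiset.exists_mem_of_ne_zero hs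
  obtain ⟨t, rfl⟩ := Multiset.exists_cons_of_mem ha
  rw [Dm_cons', pderiv_one, Dm_zero_poly]

variable (E : MvPolynomial σ ℝ →ₗ[ℝ] ℝ)

/-- Truncated chaos form. -/
def Bf (N : ℕ) (P G : MvPolynomial σ ℝ) : ℝ :=
  ∑ n ∈ Finset.range N, ((n.factorial : ℝ))⁻¹ * Sm n (fun s => E (Dm s P) * E (Dm s G))

theorem Bf_X_mul (hE : ∀ a P, E (X a * P) = E (pderiv a P)) (N : ℕ) (a : σ)
    (P G : MvPolynomial σ ℝ) :
    Bf E (N + 1) (X a * P) G = Bf E (N + 1) (pderiv a P) G + Bf E N P (pderiv a G) := by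
  have h1 : ∀ n, Sm n (fun s => E (Dm s (X a * P)) * E (Dm s G))
      = Sm n (fun s => E (Dm s (pderiv a P)) * E (Dm s G))
        + Sm n (fun s => (s.count a : ℝ) * (E (Dm (s.erase a) P) * E (Dm s G))) := by
    intro n
    rw [← Sm_add]
    refine Sm_congr fun s _ => ?_
    rw [Dm_X_mul, map_add, map_smul, hE, Dm_pderiv, smul_eq_mul]
    ring
  unfold Bf
  simp only [h1, mul_add]
  rw [Finset.sum_add_distrib]
  congr 1
  rw [Finset.sum_range_succ']
  have h0 : Sm 0 (fun s => (s.count a : ℝ) * (E (Dm (s.erase a) P) * E (Dm s G))) = 0 := by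
    rw [Sm_zero]; simp
  rw [h0, mul_zero, add_zero]
  refine Finset.sum_congr rfl fun n _ => ?_
  rw [Sm_count n a (fun s => E (Dm (s.erase a) P) * E (Dm s G))]
  simp only [Multiset.erase_cons_head, Dm_cons']
  rw [← mul_assoc]
  congr 1
  rw [Nat.factorial_succ]
  push_cast
  have : (n.factorial : ℝ) ≠ 0 := by positivity
  field_simp

/-- The chaos expansion holds for `P` against every `G`, for large truncations. -/
def GoodP (P : MvPolynomial σ ℝ) : Prop :=
  ∃ N0, ∀ N, N0 ≤ N → ∀ G, E (P * G) = Bf E N P G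

theorem GoodP_add {P Q : MvPolynomial σ ℝ} (hP : GoodP E P) (hQ : GoodP E Q) :
    GoodP E (P + Q) := by
  obtain ⟨N1, h1⟩ := hP
  obtain ⟨N2, h2⟩ := hQ
  refine ⟨max N1 N2, fun N hN G => ?_⟩
  rw [add_mul, map_add, h1 N (le_trans (le_max_left _ _) hN) G,
    h2 N (le_trans (le_max_right _ _) hN) G]
  simp only [Bf, Dm_add, map_add, add_mul, Sm_add, mul_add, Finset.sum_add_distrib]

theorem GoodP_smul {P : MvPolynomial σ ℝ} (c : ℝ) (hP : GoodP E P) :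
    GoodP E (c • P) := by
  obtain ⟨N1, h1⟩ := hP
  refine ⟨N1, fun N hN G => ?_⟩
  rw [smul_mul_assoc, map_smul, h1 N hN G]
  simp only [Bf, Dm_smul, map_smul, smul_eq_mul, mul_assoc, Sm_mul_left, Finset.mul_sum]
  refine Finset.sum_congr rfl fun n _ => ?_
  ring

theorem GoodP_one (hE1 : E 1 = 1) : GoodP E 1 := by
  refine ⟨1, fun N hN G => ?_⟩
  obtain ⟨M, rfl⟩ := Nat.exists_eq_add_of_le' hN
  rw [one_mul, Bf, Finset.sum_range_succ']
  rw [Finset.sum_eq_zero]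
  · simp [Sm_zero, Dm_zero, hE1]
  · intro n _
    have : Sm (n + 1) (fun s => E (Dm s 1) * E (Dm s G)) = 0 := by
      rw [← Sm_zero_fun (σ := σ) (n + 1)]
      refine Sm_congr fun s hs => ?_
      rw [Dm_one s (by rintro rfl; simp at hs)]
      simp
    rw [this, mul_zero]

theorem GoodP_X_mul (hE : ∀ a P, E (X a * P) = E (pderiv a P)) (a : σ) {P : MvPolynomial σ ℝ}
    (hP : GoodP E P) (hP' : GoodP E (pderiv a P)) : GoodP E (X a * P) := by
  obtain ⟨N1, h1⟩ := hP
  obtain ⟨N2, h2⟩ := hP'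
  refine ⟨max N1 N2 + 1, fun N hN G => ?_⟩
  obtain ⟨M, rfl⟩ : ∃ M, N = M + 1 := ⟨N - 1, by omega⟩
  have hN1 : N1 ≤ M := by have := le_max_left N1 N2; omega
  have hN2 : N2 ≤ M + 1 := by have := le_max_right N1 N2; omega
  rw [Bf_X_mul E hE, ← h1 M hN1, ← h2 (M + 1) hN2, mul_assoc, hE, pderiv_mul, map_add]

theorem GoodP_all (hE1 : E 1 = 1) (hE : ∀ a P, E (X a * P) = E (pderiv a P))
    (P : MvPolynomial σ ℝ) : ∀ s, GoodP E (Dm s P) := by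
  have h0 : GoodP E 0 := by simpa using GoodP_smul E 0 (GoodP_one E hE1)
  induction P using MvPolynomial.induction_on with
  | C c =>
    intro s
    have : (C c : MvPolynomial σ ℝ) = c • 1 := by rw [smul_eq_C_mul, mul_one]
    rw [this, Dm_smul]
    refine GoodP_smul E c ?_
    by_cases hs : s = 0
    · subst hs; rw [Dm_zero]; exact GoodP_one E hE1
    · rw [Dm_one s hs]; exact h0
  | add p q hp hq =>
    intro s
    rw [Dm_add]
    exact GoodP_add E (hp s) (hq s)
  | mul_X p i hp =>
    intro s
    rw [mul_comm, Dm_X_mul]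
    refine GoodP_add E (GoodP_X_mul E hE i (hp s) ?_) (GoodP_smul E _ (hp _))
    rw [← Dm_cons]
    exact hp _

/-- Wick monomials. -/
def wk (s : Multiset σ) : MvPolynomial σ ℝ :=
  ∏ a, Polynomial.aeval (X a : MvPolynomial σ ℝ) (Polynomial.hermite (s.count a))

theorem wk_zero : wk (0 : Multiset σ) = 1 := by simp [wk]

theorem pderiv_aeval_X (a b : σ) (p : Polynomial ℤ) :
    pderiv b (Polynomial.aeval (X a : MvPolynomial σ ℝ) p)
      = if a = b then Polynomial.aeval (X a : MvPolynomial σ ℝ) (Polynomial.derivative p) else 0 := by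
  induction p using Polynomial.induction_on' with
  | add p q hp hq =>
    simp only [map_add, hp, hq]
    split_ifs <;> simp
  | monomial n c =>
    rw [Polynomial.derivative_monomial, Polynomial.aeval_monomial, Polynomial.aeval_monomial]
    have hc : (algebraMap ℤ (MvPolynomial σ ℝ)) c = C (c : ℝ) := by simp
    have hc' : (algebraMap ℤ (MvPolynomial σ ℝ)) (c * n) = C ((c : ℝ) * n) := by simp
    rw [hc, hc', pderiv_C_mul, pderiv_pow]
    split_ifs with h
    · subst h
      simp
      ring
    · rw [pderiv_X_of_ne h]
      simp

theorem wk_cons (a : σ) (s : Multiset σ) :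
    wk (a ::ₘ s) = X a * wk s - pderiv a (wk s) := by
  have hrest : ∀ t : Multiset σ, pderiv a (∏ b ∈ Finset.univ.erase a,
      Polynomial.aeval (X b : MvPolynomial σ ℝ) (Polynomial.hermite (t.count b))) = 0 := by
    intro t
    have : ∀ S : Finset σ, a ∉ S → pderiv a (∏ b ∈ S,
      Polynomial.aeval (X b : MvPolynomial σ ℝ) (Polynomial.hermite (t.count b))) = 0 := by
      intro S
      induction S using Finset.induction_on with
      | empty => simp
      | insert b S hb ih =>
        intro ha
        rw [Finset.mem_insert, not_or] at ha
        rw [Finset.prod_insert hb, pderiv_mul, ih ha.2, pderiv_aeval_X, if_neg (Ne.symm ha.1)]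
        simp
    exact this _ (by simp)
  unfold wk
  rw [← Finset.mul_prod_erase _ _ (Finset.mem_univ a),
    ← Finset.mul_prod_erase Finset.univ (fun b => Polynomial.aeval (X b : MvPolynomial σ ℝ)
      (Polynomial.hermite (s.count b))) (Finset.mem_univ a)]
  rw [pderiv_mul, hrest, pderiv_aeval_X, if_pos rfl, Multiset.count_cons_self,
    Polynomial.hermite_succ]
  have : ∏ b ∈ Finset.univ.erase a, Polynomial.aeval (X b : MvPolynomial σ ℝ)
        (Polynomial.hermite ((a ::ₘ s).count b))
      = ∏ b ∈ Finset.univ.erase a, Polynomial.aeval (X b : MvPolynomial σ ℝ)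
        (Polynomial.hermite (s.count b)) := by
    refine Finset.prod_congr rfl fun b hb => ?_
    rw [Multiset.count_cons_of_ne (Finset.mem_erase.1 hb).1]
  rw [this]
  simp
  ring

theorem pderiv_wk (b : σ) (s : Multiset σ) :
    pderiv b (wk s) = (s.count b : ℝ) • wk (s.erase b) := by
  induction s using Multiset.induction_on generalizing b with
  | empty => simp [wk_zero]
  | cons a s ih =>
    have h1 : pderiv b (wk (a ::ₘ s))
        = (if a = b then wk s else 0) + (s.count b : ℝ) • wk (a ::ₘ s.erase b) := by
      rw [wk_cons, map_sub, pderiv_mul, pd_comm b a, ih b, Derivation.map_smul,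
        wk_cons, smul_sub]
      split_ifs with h
      · subst h; rw [pderiv_X_self]; simp; ring
      · rw [pderiv_X_of_ne h]; simp
    rw [h1]
    by_cases h : a = b
    · subst h
      simp only [if_true, Multiset.count_cons_self, Multiset.erase_cons_head]
      by_cases hb : a ∈ s
      · rw [Multiset.cons_erase hb]
        push_cast
        rw [add_smul, one_smul, add_comm]
      · simp [Multiset.count_eq_zero_of_notMem hb]
    · rw [if_neg h, Multiset.count_cons_of_ne (Ne.symm h), Multiset.erase_cons_tail _ h, zero_add]

theorem E_wk_mul (hE : ∀ a P, E (X a * P) = E (pderiv a P)) (s : Multiset σ)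
    (G : MvPolynomial σ ℝ) : E (wk s * G) = E (Dm s G) := by
  induction s using Multiset.induction_on generalizing G with
  | empty => simp [wk_zero, Dm_zero]
  | cons a s ih =>
    rw [wk_cons, Dm_cons', ← ih, sub_mul, map_sub, mul_assoc, hE, pderiv_mul, map_add]
    ring

/-- Multiple integral of the kernel `τ`. -/
def In (n : ℕ) (τ : Multiset σ → ℝ) : MvPolynomial σ ℝ :=
  ∑ i : Fin n → σ, τ (Multiset.map i Finset.univ.val) • wk (Multiset.map i Finset.univ.val)

theorem In_linear (n : ℕ) (τ : Multiset σ → ℝ) (L : MvPolynomial σ ℝ →ₗ[ℝ] ℝ) :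
    L (In n τ) = Sm n (fun s => τ s * L (wk s)) := by
  simp [In, Sm]

theorem In_coeff (n : ℕ) (τ : Multiset σ → ℝ) (m : σ →₀ ℕ) :
    coeff m (In n τ) = Sm n (fun s => τ s * coeff m (wk s)) :=
  In_linear n τ (MvPolynomial.lcoeff ℝ m)

theorem pderiv_In_zero (a : σ) (τ : Multiset σ → ℝ) : pderiv a (In 0 τ) = 0 := by
  simp [In, wk_zero]

theorem pderiv_In (n : ℕ) (a : σ) (τ : Multiset σ → ℝ) :
    pderiv a (In (n + 1) τ) = (n + 1 : ℝ) • In n (fun s => τ (a ::ₘ s)) := by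
  ext m
  have h := In_linear (n + 1) τ ((MvPolynomial.lcoeff ℝ m).comp (pderiv (R := ℝ) a).toLinearMap)
  refine Eq.trans h ?_
  have h2 := Sm_count n a (fun s => τ s * coeff m (wk (s.erase a)))
  simp only [Multiset.erase_cons_head] at h2
  rw [coeff_smul, In_coeff, smul_eq_mul, ← h2]
  refine Sm_congr fun s _ => ?_
  simp [pderiv_wk]
  ring

theorem Dm_In (s : Multiset σ) (n : ℕ) (τ : Multiset σ → ℝ) :
    (n.factorial : ℝ) • Dm s (In (n + s.card) τ)
      = ((n + s.card).factorial : ℝ) • In n (fun t => τ (s + t)) := by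
  induction s using Multiset.induction_on generalizing τ with
  | empty => simp [Dm_zero]
  | cons a s ih =>
    rw [Dm_cons', Multiset.card_cons, ← add_assoc, pderiv_In, Dm_smul, smul_comm, ih, smul_smul]
    congr 1
    · rw [Nat.factorial_succ]; push_cast; ring
    · simp only [Multiset.cons_add]

theorem Dm_In_zero (s : Multiset σ) (n : ℕ) (h : n < s.card) (τ : Multiset σ → ℝ) :
    Dm s (In n τ) = 0 := by
  induction s using Multiset.induction_on generalizing n τ with
  | empty => simp at h
  | cons a s ih =>
    rw [Dm_cons']
    cases n with
    | zero => rw [pderiv_In_zero, Dm_zero_poly]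
    | succ n =>
      rw [Multiset.card_cons] at h
      rw [pderiv_In, Dm_smul, ih n (by omega), smul_zero]

theorem E_In_pos (hE : ∀ a P, E (X a * P) = E (pderiv a P)) (n : ℕ)
    (hn : n ≠ 0) (τ : Multiset σ → ℝ) : E (In n τ) = 0 := by
  rw [In_linear, ← Sm_zero_fun (σ := σ) n]
  refine Sm_congr fun s hs => ?_
  have := E_wk_mul E hE s 1
  rw [mul_one, Dm_one s (by rintro rfl; simp at hs; exact hn hs.symm), map_zero] at this
  rw [this, mul_zero]

theorem E_In_zero (hE1 : E 1 = 1) (τ : Multiset σ → ℝ) : E (In 0 τ) = τ 0 := by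
  simp [In_linear, Sm_zero, wk_zero, hE1]

theorem E_In_mul (hE : ∀ a P, E (X a * P) = E (pderiv a P)) (n : ℕ)
    (τ : Multiset σ → ℝ) (G : MvPolynomial σ ℝ) :
    E (In n τ * G) = Sm n (fun s => τ s * E (Dm s G)) := by
  have h := In_linear n τ (E.comp ((LinearMap.mul ℝ (MvPolynomial σ ℝ)).flip G))
  simp only [LinearMap.comp_apply, LinearMap.flip_apply, LinearMap.mul_apply'] at h
  rw [h]
  simp only [E_wk_mul E hE]

theorem E_In_In_ne (hE : ∀ a P, E (X a * P) = E (pderiv a P)) (m n : ℕ)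
    (hmn : m ≠ n) (α β : Multiset σ → ℝ) : E (In m α * In n β) = 0 := by
  rw [E_In_mul E hE, ← Sm_zero_fun (σ := σ) m]
  refine Sm_congr fun s hs => ?_
  rcases lt_or_gt_of_ne hmn with h | h
  · obtain ⟨q, rfl⟩ := Nat.exists_eq_add_of_lt h
    have h2 := congrArg E (Dm_In s (q + 1) β)
    rw [map_smul, map_smul, E_In_pos E hE _ (by omega), smul_zero, hs,
      show q + 1 + m = m + q + 1 by ring] at h2
    have h3 : ((q + 1).factorial : ℝ) ≠ 0 := by positivity
    rw [(smul_eq_zero.1 h2).resolve_left h3, mul_zero]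
  · rw [Dm_In_zero s n (by omega), map_zero, mul_zero]

theorem E_In_In (hE1 : E 1 = 1) (hE : ∀ a P, E (X a * P) = E (pderiv a P)) (n : ℕ)
    (α β : Multiset σ → ℝ) :
    E (In n α * In n β) = (n.factorial : ℝ) * Sm n (fun s => α s * β s) := by
  rw [E_In_mul E hE, ← Sm_mul_left]
  refine Sm_congr fun s hs => ?_
  have h2 := congrArg E (Dm_In s 0 β)
  rw [map_smul, map_smul, E_In_zero E hE1, hs, Nat.factorial_zero, Nat.cast_one, one_smul,
    zero_add, add_zero, smul_eq_mul] at h2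
  rw [h2]
  ring

end Poly

section Kurt

open MvPolynomial

variable {σ : Type*} [Fintype σ] [DecidableEq σ]

/-- Squared norm of the `r`-th contraction. -/
def Rf (k r : ℕ) (τ : Multiset σ → ℝ) : ℝ :=
  Sm (k - r) (fun u => Sm (k - r) (fun v => (Sm r (fun t => τ (u + t) * τ (v + t))) ^ 2))

theorem Rf_nonneg (k r : ℕ) (τ : Multiset σ → ℝ) : 0 ≤ Rf k r τ :=
  Sm_nonneg fun _ _ => Sm_nonneg fun _ _ => sq_nonneg _

/-- The constants in the chaos expansion of the square. -/
def cc (k m : ℕ) : ℝ := (k.factorial : ℝ) ^ 2 / ((k - m).factorial : ℝ)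

variable (E : MvPolynomial σ ℝ →ₗ[ℝ] ℝ)

theorem Dm_In' (u : Multiset σ) (k : ℕ) (hu : u.card ≤ k) (τ : Multiset σ → ℝ) :
    Dm u (In k τ) = ((k.factorial : ℝ) / ((k - u.card).factorial : ℝ)) •
      In (k - u.card) (fun t => τ (u + t)) := by
  have h := Dm_In u (k - u.card) τ
  rw [Nat.sub_add_cancel hu] at h
  have h3 : ((k - u.card).factorial : ℝ) ≠ 0 := by positivity
  rw [div_eq_inv_mul, mul_smul, ← h, smul_smul, inv_mul_cancel₀ h3, one_smul]

theorem E_DD (hE1 : E 1 = 1) (hE : ∀ a P, E (X a * P) = E (pderiv a P)) (k : ℕ)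
    (τ : Multiset σ → ℝ) (u v : Multiset σ) :
    E (Dm u (In k τ) * Dm v (In k τ)) = if u.card = v.card ∧ u.card ≤ k then
      cc k u.card * Sm (k - u.card) (fun t => τ (u + t) * τ (v + t)) else 0 := by
  by_cases hu : u.card ≤ k
  swap
  · rw [Dm_In_zero u k (by omega)]
    simp [hu]
  by_cases hv : v.card ≤ k
  swap
  · rw [Dm_In_zero v k (by omega), if_neg (by omega)]
    simp
  rw [Dm_In' u k hu, Dm_In' v k hv, smul_mul_smul_comm, map_smul, smul_eq_mul]
  split_ifs with h
  · rw [← h.1, E_In_In E hE1 hE, cc]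
    have h3 : ((k - u.card).factorial : ℝ) ≠ 0 := by positivity
    field_simp
  · rw [E_In_In_ne E hE _ _ (by omega), mul_zero]

theorem E_D_sq (hE1 : E 1 = 1) (hE : ∀ a P, E (X a * P) = E (pderiv a P)) (k : ℕ)
    (τ : Multiset σ → ℝ) (s : Multiset σ) :
    E (Dm s (In k τ * In k τ)) = AD s (fun u v => if u.card = v.card ∧ u.card ≤ k then
      cc k u.card * Sm (k - u.card) (fun t => τ (u + t) * τ (v + t)) else 0) := by
  rw [Dm_mul]
  refine Eq.trans (AD_map E.toAddMonoidHom s _) ?_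
  refine AD_congr fun u v _ => ?_
  exact E_DD E hE1 hE k τ u v

/-- The terms of the expansion of the fourth moment. -/
def Nf (k m : ℕ) (τ : Multiset σ → ℝ) : ℝ :=
  Sm (m + m) (fun s => (AD s (fun u v => if u.card = m then
      Sm (k - m) (fun t => τ (u + t) * τ (v + t)) else 0)) ^ 2)

theorem Nf_nonneg (k m : ℕ) (τ : Multiset σ → ℝ) : 0 ≤ Nf k m τ :=
  Sm_nonneg fun _ _ => sq_nonneg _

theorem E_four (hE1 : E 1 = 1) (hE : ∀ a P, E (X a * P) = E (pderiv a P)) (k : ℕ)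
    (τ : Multiset σ → ℝ) :
    E (In k τ * In k τ * (In k τ * In k τ)) = ∑ m ∈ Finset.range (k + 1),
      (((m + m).factorial : ℝ))⁻¹ * (cc k m ^ 2 * Nf k m τ) := by
  obtain ⟨N0, hN⟩ := GoodP_all E hE1 hE (In k τ * In k τ) 0
  rw [Dm_zero] at hN
  rw [hN (max N0 (2 * k + 1)) (le_max_left _ _), Bf]
  have hinj : Function.Injective (fun m : ℕ => m + m) := fun a b h => by
    simp only at h; omega
  rw [← Finset.sum_subset (s₁ := (Finset.range (k + 1)).map ⟨fun m : ℕ => m + m, hinj⟩)]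
  · rw [Finset.sum_map]
    refine Finset.sum_congr rfl fun m hm => ?_
    simp only [Function.Embedding.coeFn_mk]
    congr 1
    rw [Nf, ← Sm_mul_left]
    refine Sm_congr fun s hs => ?_
    rw [← sq, ← mul_pow, ← AD_mul_left, E_D_sq E hE1 hE]
    congr 1
    refine AD_congr fun u v huv => ?_
    have hc : u.card + v.card = m + m := by rw [← hs, ← huv, Multiset.card_add]
    rw [Finset.mem_range] at hm
    by_cases h : u.card = m
    · rw [if_pos (by omega), if_pos h, h]
    · rw [if_neg (by omega), if_neg h, mul_zero]
  · intro n hn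
    simp only [Finset.mem_map, Finset.mem_range, Function.Embedding.coeFn_mk] at hn ⊢
    have := le_max_right N0 (2 * k + 1)
    obtain ⟨m, hm, rfl⟩ := hn
    omega
  · intro n _ hn
    have : Sm n (fun s => E (Dm s (In k τ * In k τ)) * E (Dm s (In k τ * In k τ))) = 0 := by
      rw [← Sm_zero_fun (σ := σ) n]
      refine Sm_congr fun s hs => ?_
      have h0 : E (Dm s (In k τ * In k τ)) = 0 := by
        rw [E_D_sq E hE1 hE]
        refine Eq.trans (AD_congr (ψ := fun _ _ => 0) fun u v huv => ?_) (AD_zero_fun s)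
        have hc : u.card + v.card = n := by rw [← hs, ← huv, Multiset.card_add]
        rw [if_neg]
        rintro ⟨h1, h2⟩
        apply hn
        simp only [Finset.mem_map, Finset.mem_range, Function.Embedding.coeFn_mk]
        exact ⟨u.card, by omega, by omega⟩
      rw [h0, mul_zero]
    rw [this, mul_zero]

theorem Nf_le (k m : ℕ) (hm : m ≤ k) (τ : Multiset σ → ℝ) :
    Nf k m τ ≤ 2 ^ (m + m) * (((m + m).choose m : ℝ) * Rf k (k - m) τ) := by
  rw [Rf, Nat.sub_sub_self hm, ← Sm_AD_card m m, ← Sm_mul_left, Nf]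
  refine Sm_le fun s hs => ?_
  refine le_trans (AD_sq_le _ _) ?_
  rw [hs]
  refine le_of_eq ?_
  congr 1
  refine AD_congr fun u v _ => ?_
  split_ifs <;> simp

theorem Sm_AD_swap (n : ℕ) (u : Multiset σ)
    (φ : Multiset σ → Multiset σ → Multiset σ → ℝ) :
    Sm n (fun v => AD u (φ v)) = AD u (fun a b => Sm n (fun v => φ v a b)) := by
  induction u using Multiset.induction_on generalizing φ with
  | empty => simp [AD_zero]
  | cons a u ih => simp only [AD_cons, Sm_add, ih]

theorem Nf_top (k : ℕ) (τ : Multiset σ → ℝ) :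
    Nf k k τ = ((k + k).choose k : ℝ) * ∑ p ∈ Finset.range (k + 1),
      (k.choose p : ℝ) ^ 2 * Rf k p τ := by
  set h : Multiset σ → ℝ := fun s => AD s (fun u v => if u.card = k then τ u * τ v else 0) with hh
  have e1 : Nf k k τ = Sm (k + k) (fun s => AD s (fun u v => if u.card = k then
      τ u * τ v * h (u + v) else 0)) := by
    unfold Nf
    refine Sm_congr fun s _ => ?_
    have : AD s (fun u v => if u.card = k then Sm (k - k) (fun t => τ (u + t) * τ (v + t)) else 0)
      = h s := by
      refine AD_congr fun u v _ => ?_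
      simp [Sm_zero]
    rw [this, sq]
    conv_lhs => rw [hh]
    simp only
    rw [mul_comm, ← AD_mul_left]
    refine AD_congr fun u v huv => ?_
    rw [huv]
    split_ifs
    · ring
    · simp
  rw [e1, Sm_AD_card]
  congr 1
  have e2 : ∀ u v, τ u * τ v * h (u + v) = AD u (fun a b => AD v (fun c e =>
      if (a + c).card = k then (τ (a + b) * τ (c + e)) * (τ (a + c) * τ (b + e)) else 0)) := by
    intro u v
    simp only [hh]
    rw [AD_add, ← AD_mul_left]
    refine AD_congr fun a b hab => ?_
    rw [← AD_mul_left]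
    refine AD_congr fun c e hce => ?_
    rw [hab, hce]
    split_ifs <;> simp
  simp only [e2, Sm_AD_swap]
  rw [Sm_AD, Finset.Nat.sum_antidiagonal_eq_sum_range_succ_mk]
  refine Finset.sum_congr rfl fun p hp => ?_
  have hpk : p ≤ k := by rw [Finset.mem_range] at hp; omega
  simp only
  have e3 : ∀ a b : Multiset σ, a.card = p → Sm k (fun v => AD v (fun c e =>
      if (a + c).card = k then (τ (a + b) * τ (c + e)) * (τ (a + c) * τ (b + e)) else 0))
      = (k.choose p : ℝ) * Sm (k - p) (fun c => Sm p (fun e =>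
        (τ (a + b) * τ (c + e)) * (τ (a + c) * τ (b + e)))) := by
    intro a b ha
    have h4 := Sm_AD_card (k - p) p (fun c e =>
      (τ (a + b) * τ (c + e)) * (τ (a + c) * τ (b + e)))
    rw [Nat.sub_add_cancel hpk, Nat.choose_symm hpk] at h4
    rw [← h4]
    refine Sm_congr fun v _ => AD_congr fun c e _ => ?_
    have : (a + c).card = k ↔ c.card = k - p := by
      rw [Multiset.card_add, ha]; omega
    simp only [this]
  have e4 : Sm p (fun a => Sm (k - p) (fun b => Sm k (fun v => AD v (fun c e =>
      if (a + c).card = k then (τ (a + b) * τ (c + e)) * (τ (a + c) * τ (b + e)) else 0))))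
      = (k.choose p : ℝ) * Rf k p τ := by
    rw [Sm_congr (g := fun a => (k.choose p : ℝ) * Sm (k - p) (fun b => Sm (k - p) (fun c =>
      Sm p (fun e => (τ (a + b) * τ (c + e)) * (τ (a + c) * τ (b + e))))))
      (fun a ha => by rw [← Sm_mul_left]; exact Sm_congr fun b _ => e3 a b ha)]
    rw [Sm_mul_left, Sm_comm, Rf]
    congr 1
    refine Sm_congr fun b _ => ?_
    rw [Sm_comm]
    refine Sm_congr fun c _ => ?_
    rw [sq, ← Sm_mul_right]
    refine Sm_congr fun a _ => ?_
    rw [← Sm_mul_left]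
    refine Sm_congr fun e _ => ?_
    rw [add_comm b a, add_comm c a]
    ring
  rw [e4]
  ring

/-- Exact expansion of the excess kurtosis. -/
theorem excess_formula (hE1 : E 1 = 1) (hE : ∀ a P, E (X a * P) = E (pderiv a P)) (j : ℕ)
    (τ : Multiset σ → ℝ) :
    E (In (j + 1) τ * In (j + 1) τ * (In (j + 1) τ * In (j + 1) τ))
        - 3 * (E (In (j + 1) τ * In (j + 1) τ)) ^ 2
      = ∑ i ∈ Finset.range j, ((((i + 1) + (i + 1)).factorial : ℝ))⁻¹ *
          (cc (j + 1) (i + 1) ^ 2 * Nf (j + 1) (i + 1) τ)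
        + ((j + 1).factorial : ℝ) ^ 2 * ∑ i ∈ Finset.range j,
          ((j + 1).choose (i + 1) : ℝ) ^ 2 * Rf (j + 1) (i + 1) τ := by
  rw [E_four E hE1 hE, E_In_In E hE1 hE, Finset.sum_range_succ, Finset.sum_range_succ', Nf_top,
    Finset.sum_range_succ, Finset.sum_range_succ']
  have r0 : Rf (j + 1) 0 τ = (Sm (j + 1) (fun s => τ s * τ s)) ^ 2 := by
    simp only [Rf, Sm_zero, add_zero, Nat.sub_zero]
    rw [sq, ← Sm_mul_right]
    refine Sm_congr fun u _ => ?_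
    rw [← Sm_mul_left]
    refine Sm_congr fun v _ => ?_
    ring
  have rk : Rf (j + 1) (j + 1) τ = (Sm (j + 1) (fun s => τ s * τ s)) ^ 2 := by
    simp [Rf, Sm_zero]
  have n0 : Nf (j + 1) 0 τ = (Sm (j + 1) (fun s => τ s * τ s)) ^ 2 := by
    simp [Nf, Sm_zero, AD_zero]
  rw [r0, rk, n0]
  have hch : (((j + 1) + (j + 1)).choose (j + 1) : ℝ)
      = (((j + 1) + (j + 1)).factorial : ℝ) / ((j + 1).factorial : ℝ) ^ 2 := by
    rw [Nat.add_choose, Nat.cast_div (Nat.factorial_mul_factorial_dvd_factorial_add _ _)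
      (by positivity)]
    push_cast
    ring
  have c0 : cc (j + 1) 0 = ((j + 1).factorial : ℝ) := by
    have : ((j + 1).factorial : ℝ) ≠ 0 := by positivity
    simp only [cc, Nat.sub_zero]
    field_simp
  have ck : cc (j + 1) (j + 1) = ((j + 1).factorial : ℝ) ^ 2 := by
    simp [cc]
  rw [hch, c0, ck]
  have h1 : ((j + 1).factorial : ℝ) ≠ 0 := by positivity
  have h2 : (((j + 1) + (j + 1)).factorial : ℝ) ≠ 0 := by positivity
  simp only [Nat.choose_zero_right, Nat.choose_self, Nat.cast_one, add_zero, Nat.factorial_zero]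
  generalize (∑ i ∈ Finset.range j, ((((i + 1) + (i + 1)).factorial : ℝ))⁻¹ *
          (cc (j + 1) (i + 1) ^ 2 * Nf (j + 1) (i + 1) τ)) = A
  generalize (∑ i ∈ Finset.range j,
          ((j + 1).choose (i + 1) : ℝ) ^ 2 * Rf (j + 1) (i + 1) τ) = B
  generalize Sm (j + 1) (fun s => τ s * τ s) = S
  generalize (((j + 1) + (j + 1)).factorial : ℝ) = f at *
  field_simp
  ring

end Kurt

theorem ms_count {k d : ℕ} (i : Fin k → Fin d) (a : Fin d) :
    (Multiset.map i Finset.univ.val).count a = typeOf i a := by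
  rw [Multiset.count_map, typeOf, Finset.card_def, Finset.filter_val]
  congr 1
  refine Multiset.filter_congr fun t _ => ?_
  exact eq_comm

theorem sym_ms {k d : ℕ} {T : (Fin k → Fin d) → ℝ} (hT : SymTensor d k T)
    {i j : Fin k → Fin d}
    (h : Multiset.map i Finset.univ.val = Multiset.map j Finset.univ.val) : T i = T j := by
  have hc : ∀ a, Nonempty ({t // i t = a} ≃ {t // j t = a}) := by
    intro a
    refine ⟨Fintype.equivOfCardEq ?_⟩
    rw [Fintype.card_subtype, Fintype.card_subtype]
    have := congrArg (Multiset.count a) h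
    rw [ms_count, ms_count] at this
    exact this
  let e := Equiv.ofFiberEquiv (fun a => (hc a).some)
  have he : j ∘ e = i := funext fun t => Equiv.ofFiberEquiv_map (fun a => (hc a).some) t
  rw [← he]
  exact hT e j

theorem exists_kernel {k d : ℕ} {T : (Fin k → Fin d) → ℝ} (hT : SymTensor d k T) :
    ∃ τ : Multiset (Fin d) → ℝ, ∀ i, T i = τ (Multiset.map i Finset.univ.val) := by
  classical
  refine ⟨fun s => if h : ∃ i : Fin k → Fin d, Multiset.map i Finset.univ.val = s
    then T h.choose else 0, fun i => ?_⟩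
  have h : ∃ i' : Fin k → Fin d, Multiset.map i' Finset.univ.val
    = Multiset.map i Finset.univ.val := ⟨i, rfl⟩
  simp only [dif_pos h]
  exact sym_ms hT h.choose_spec.symm

theorem ms_splitIdx {d k r : ℕ} (hr : r ≤ k) (i : Fin (k - r) → Fin d) (a : Fin r → Fin d) :
    Multiset.map (splitIdx d k r i a) Finset.univ.val
      = Multiset.map i Finset.univ.val + Multiset.map a Finset.univ.val := by
  have key : ∀ f : Fin d → Multiset (Fin d), ∑ t, f (splitIdx d k r i a t)
      = ∑ t, f (i t) + ∑ t, f (a t) := by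
    intro f
    rw [← (finCongr (Nat.sub_add_cancel hr)).sum_comp, Fin.sum_univ_add]
    congr 1
    · refine Finset.sum_congr rfl fun t _ => ?_
      simp [splitIdx]
    · refine Finset.sum_congr rfl fun t _ => ?_
      simp [splitIdx]
  have h2 : ∀ (n : ℕ) (g : Fin n → Fin d), Multiset.map g Finset.univ.val
      = ∑ t, ({g t} : Multiset (Fin d)) := by
    intro n g
    rw [← Multiset.sum_map_singleton (Multiset.map g Finset.univ.val), Multiset.map_map]
    rfl
  rw [h2, h2, h2]
  exact key (fun x => {x})

theorem contr_eq {d k r : ℕ} (hr : r ≤ k) {T : (Fin k → Fin d) → ℝ} {τ : Multiset (Fin d) → ℝ}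
    (h : ∀ i, T i = τ (Multiset.map i Finset.univ.val)) :
    contrNormSq d k r T T = Rf k r τ := by
  unfold contrNormSq Rf Sm
  rw [Fintype.sum_prod_type]
  simp only [h, ms_splitIdx hr]

theorem Qchaos_eq {d k : ℕ} {T : (Fin k → Fin d) → ℝ} {τ : Multiset (Fin d) → ℝ}
    (h : ∀ i, T i = τ (Multiset.map i Finset.univ.val)) (x : Fin d → ℝ) :
    Qchaos d k T x = MvPolynomial.eval x (In k τ) := by
  unfold Qchaos In
  rw [map_sum, Finset.mul_sum]
  refine Finset.sum_congr rfl fun i _ => ?_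
  rw [MvPolynomial.smul_eval, ← h, wk, map_prod, Htensor]
  have e : ∀ a, MvPolynomial.eval x (Polynomial.aeval (MvPolynomial.X a : MvPolynomial (Fin d) ℝ)
      (Polynomial.hermite ((Multiset.map i Finset.univ.val).count a)))
      = Real.sqrt ((typeOf i a).factorial : ℝ) * He (typeOf i a) (x a) := by
    intro a
    rw [ms_count, He, mul_div_cancel₀ _ (by positivity)]
    have := Polynomial.hom_eval₂ (Polynomial.hermite (typeOf i a))
      (algebraMap ℤ (MvPolynomial (Fin d) ℝ)) (MvPolynomial.eval x) (MvPolynomial.X a)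
    rw [Polynomial.aeval_def, this, Polynomial.aeval_def, MvPolynomial.eval_X]
    congr 1
    exact RingHom.ext_int _ _
  rw [Finset.prod_congr rfl fun a _ => e a, Finset.prod_mul_distrib,
    ← Real.sqrt_prod _ (fun a _ => by positivity), Real.sqrt_div (by positivity)]
  have : Real.sqrt (k.factorial : ℝ) ≠ 0 := by positivity
  field_simp

/-- **Lemma B.2**: two-sided excess-kurtosis bound via tensor contractions for a fixed
Wiener chaos, with constants depending only on the order `k`. -/
theorem excess_kurtosis_tensor_contractions (k : ℕ) (hk : 1 ≤ k) :
    ∃ C : ℝ, 0 < C ∧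
      ∀ d : ℕ, 1 ≤ d → ∀ T : (Fin k → Fin d) → ℝ, SymTensor d k T →
        C⁻¹ * (⨆ r ∈ Finset.Icc 1 (k - 1), contrNormSq d k r T T) ≤
            (∫ x, (Qchaos d k T x) ^ 4 ∂(stdG (Fin d))) -
              3 * (∫ x, (Qchaos d k T x) ^ 2 ∂(stdG (Fin d))) ^ 2 ∧
          (∫ x, (Qchaos d k T x) ^ 4 ∂(stdG (Fin d))) -
              3 * (∫ x, (Qchaos d k T x) ^ 2 ∂(stdG (Fin d))) ^ 2 ≤
            C * (⨆ r ∈ Finset.Icc 1 (k - 1), contrNormSq d k r T T) := by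

  obtain ⟨j, rfl⟩ : ∃ j, k = j + 1 := ⟨k - 1, by omega⟩
  set A : ℕ → ℝ := fun i => ((((i + 1) + (i + 1)).factorial : ℝ))⁻¹ *
          (cc (j + 1) (i + 1) ^ 2 * (2 ^ ((i + 1) + (i + 1)) *
            (((i + 1) + (i + 1)).choose (i + 1) : ℝ))) with hA
  set B : ℕ → ℝ := fun i => ((j + 1).factorial : ℝ) ^ 2 * ((j + 1).choose (i + 1) : ℝ) ^ 2 with hB
  have hA0 : ∀ i, 0 ≤ A i := fun i => by simp only [hA]; positivity
  have hB0 : ∀ i, 0 ≤ B i := fun i => by simp only [hB]; positivity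
  have hsum0 : 0 ≤ ∑ i ∈ Finset.range j, (A i + B i) :=
    Finset.sum_nonneg fun i _ => add_nonneg (hA0 i) (hB0 i)
  refine ⟨1 + ∑ i ∈ Finset.range j, (A i + B i), by linarith, ?_⟩
  intro d _ T hT
  obtain ⟨τ, hτ⟩ := exists_kernel hT
  set S : ℝ := ⨆ r ∈ Finset.Icc 1 (j + 1 - 1), contrNormSq d (j + 1) r T T with hS
  have hval : ∀ r, (⨆ (_ : r ∈ Finset.Icc 1 (j + 1 - 1)), contrNormSq d (j + 1) r T T)
      = if r ∈ Finset.Icc 1 (j + 1 - 1) then Rf (j + 1) r τ else 0 := by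
    intro r
    split_ifs with h
    · rw [ciSup_pos h]
      rw [Finset.mem_Icc] at h
      exact contr_eq (by omega) hτ
    · have : IsEmpty (r ∈ Finset.Icc 1 (j + 1 - 1)) := ⟨h⟩
      exact Real.iSup_of_isEmpty _
  have hSdef : S = ⨆ r, if r ∈ Finset.Icc 1 (j + 1 - 1) then Rf (j + 1) r τ else 0 := by
    rw [hS]; exact congrArg iSup (funext hval)
  have hbdd : BddAbove (Set.range
      (fun r => if r ∈ Finset.Icc 1 (j + 1 - 1) then Rf (j + 1) r τ else 0)) := by
    refine ⟨∑ r ∈ Finset.Icc 1 (j + 1 - 1), Rf (j + 1) r τ, ?_⟩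
    rintro _ ⟨r, rfl⟩
    simp only
    split_ifs with h
    · exact Finset.single_le_sum (fun r _ => Rf_nonneg (j + 1) r τ) h
    · exact Finset.sum_nonneg fun r _ => Rf_nonneg (j + 1) r τ
  have hRS : ∀ r, 1 ≤ r → r ≤ j → Rf (j + 1) r τ ≤ S := by
    intro r h1 h2
    rw [hSdef]
    have := le_ciSup hbdd r
    rwa [if_pos (by rw [Finset.mem_Icc]; omega)] at this
  have hS0 : 0 ≤ S := by
    rw [hSdef]
    refine Real.iSup_nonneg fun r => ?_
    split_ifs
    · exact Rf_nonneg _ _ _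
    · exact le_rfl
  have h4 : ∫ x, (Qchaos d (j + 1) T x) ^ 4 ∂(stdG (Fin d))
      = EG d (In (j + 1) τ * In (j + 1) τ * (In (j + 1) τ * In (j + 1) τ)) := by
    simp only [EG, LinearMap.coe_mk, AddHom.coe_mk, map_mul, Qchaos_eq hτ]
    congr 1; ext x; ring
  have h2 : ∫ x, (Qchaos d (j + 1) T x) ^ 2 ∂(stdG (Fin d))
      = EG d (In (j + 1) τ * In (j + 1) τ) := by
    simp only [EG, LinearMap.coe_mk, AddHom.coe_mk, map_mul, Qchaos_eq hτ]
    congr 1; ext x; ring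
  rw [h4, h2, excess_formula (EG d) (EG_one d) (EG_ibp d)]
  have hN0 : ∀ i, 0 ≤ ((((i + 1) + (i + 1)).factorial : ℝ))⁻¹ *
          (cc (j + 1) (i + 1) ^ 2 * Nf (j + 1) (i + 1) τ) := fun i =>
    mul_nonneg (by positivity) (mul_nonneg (sq_nonneg _) (Nf_nonneg _ _ _))
  constructor
  · set X : ℝ := ∑ i ∈ Finset.range j, ((((i + 1) + (i + 1)).factorial : ℝ))⁻¹ *
          (cc (j + 1) (i + 1) ^ 2 * Nf (j + 1) (i + 1) τ)
        + ((j + 1).factorial : ℝ) ^ 2 * ∑ i ∈ Finset.range j,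
          ((j + 1).choose (i + 1) : ℝ) ^ 2 * Rf (j + 1) (i + 1) τ with hX
    have hX1 : 0 ≤ ∑ i ∈ Finset.range j, ((((i + 1) + (i + 1)).factorial : ℝ))⁻¹ *
          (cc (j + 1) (i + 1) ^ 2 * Nf (j + 1) (i + 1) τ) :=
      Finset.sum_nonneg fun i _ => hN0 i
    have hterm : ∀ i, 0 ≤ ((j + 1).choose (i + 1) : ℝ) ^ 2 * Rf (j + 1) (i + 1) τ := fun i =>
      mul_nonneg (sq_nonneg _) (Rf_nonneg _ _ _)
    have hX2 : 0 ≤ ∑ i ∈ Finset.range j,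
          ((j + 1).choose (i + 1) : ℝ) ^ 2 * Rf (j + 1) (i + 1) τ :=
      Finset.sum_nonneg fun i _ => hterm i
    have hf : (1 : ℝ) ≤ ((j + 1).factorial : ℝ) ^ 2 :=
      one_le_pow₀ (by exact_mod_cast Nat.factorial_pos (j + 1))
    have hSX : S ≤ X := by
      rw [hSdef]
      refine ciSup_le fun r => ?_
      split_ifs with h
      · rw [Finset.mem_Icc] at h
        obtain ⟨i, rfl⟩ : ∃ i, r = i + 1 := ⟨r - 1, by omega⟩
        have hs := Finset.single_le_sum (f := fun i => ((j + 1).choose (i + 1) : ℝ) ^ 2 *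
          Rf (j + 1) (i + 1) τ) (fun i _ => hterm i) (Finset.mem_range.2 (show i < j by omega))
        have hch : (1 : ℝ) ≤ ((j + 1).choose (i + 1) : ℝ) ^ 2 :=
          one_le_pow₀ (by exact_mod_cast Nat.choose_pos (by omega))
        have hR := Rf_nonneg (j + 1) (i + 1) τ
        nlinarith
      · rw [hX]
        have := mul_nonneg (le_trans zero_le_one hf) hX2
        linarith
    refine le_trans ?_ hSX
    refine mul_le_of_le_one_left hS0 ?_
    exact inv_le_one_of_one_le₀ (by linarith)
  · rw [Finset.mul_sum, ← Finset.sum_add_distrib]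
    have : ∑ i ∈ Finset.range j, (((((i + 1) + (i + 1)).factorial : ℝ))⁻¹ *
          (cc (j + 1) (i + 1) ^ 2 * Nf (j + 1) (i + 1) τ)
        + ((j + 1).factorial : ℝ) ^ 2 *
          (((j + 1).choose (i + 1) : ℝ) ^ 2 * Rf (j + 1) (i + 1) τ))
        ≤ ∑ i ∈ Finset.range j, (A i + B i) * S := by
      refine Finset.sum_le_sum fun i hi => ?_
      rw [Finset.mem_range] at hi
      rw [add_mul]
      refine add_le_add ?_ ?_
      · simp only [hA]
        rw [mul_assoc, mul_assoc, mul_assoc]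
        refine mul_le_mul_of_nonneg_left ?_ (by positivity)
        refine mul_le_mul_of_nonneg_left ?_ (sq_nonneg _)
        refine le_trans (Nf_le (j + 1) (i + 1) (by omega) τ) ?_
        refine mul_le_mul_of_nonneg_left ?_ (by positivity)
        refine mul_le_mul_of_nonneg_left ?_ (by positivity)
        exact hRS _ (by omega) (by omega)
      · simp only [hB]
        rw [mul_assoc]
        refine mul_le_mul_of_nonneg_left ?_ (by positivity)
        refine mul_le_mul_of_nonneg_left ?_ (by positivity)
        exact hRS _ (by omega) (by omega)
    refine le_trans this ?_
    rw [← Finset.sum_mul]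
    refine mul_le_mul_of_nonneg_right (by linarith) hS0
end
end
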